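/- arXiv:2405.18781 — 10 statements merged into one kernel-verified Lean document; each statement's English description precedes it below -/
import Mathlib

section
/- Let N ≥ 1 and let {A^{(n)}}_{n≥0} be a sequence of row-stochastic N×N matrices. For x^{(0)} ∈ ℝ^N define x^{(t+1)} = A^{(t)} x^{(t)}, and set m^{(t)} = min_i x_i^{(t)} and M^{(t)} = max_i x_i^{(t)}. Fix an index i, a time t ≥ 0 and p ∈ [0,1]. (a) If x_i^{(t)} = p m^{(t)} + (1−p) M^{(t)}, then for every T ≥ 1, x_i^{(t+T)} ≤ p (∏_{n=t}^{t+T−1} A_{ii}^{(n)}) m^{(t)} + (1 − p ∏_{n=t}^{t+T−1} A_{ii}^{(n)}) M^{(t)}. (b) Symmetrically, if x_i^{(t)} = p M^{(t)} + (1−p) m^{(t)}, then for every T ≥ 1, x_i^{(t+T)} ≥ p (∏_{n=t}^{t+T−1} A_{ii}^{(n)}) M^{(t)} + (1 − p ∏_{n=t}^{t+T−1} A_{ii}^{(n)}) m^{(t)}. -/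
theorem sub_mulVec_ge_diag_mul {ι : Type*} [Fintype ι] {A : Matrix ι ι ℝ}
    (hA : ∀ i j, 0 ≤ A i j) (hsum : ∀ i, ∑ j, A i j = 1) {v : ι → ℝ} {C : ℝ}
    (hv : ∀ k, v k ≤ C) (i : ι) : A i i * (C - v i) ≤ C - A.mulVec v i := by
  have h : C - A.mulVec v i = ∑ j, A i j * (C - v j) := by
    simp only [mul_sub, Finset.sum_sub_distrib, ← Finset.sum_mul, hsum, one_mul]
    rfl
  rw [h]
  exact Finset.single_le_sum (f := fun j => A i j * (C - v j))
    (fun j _ => mul_nonneg (hA i j) (sub_nonneg.2 (hv j))) (Finset.mem_univ i)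

/-- The gap between a coordinate and a common upper bound shrinks at most by the product of the
diagonal entries. -/
theorem prod_diag_mul_gap_le {ι : Type*} [Fintype ι] {A : ℕ → Matrix ι ι ℝ}
    (hA : ∀ n i j, 0 ≤ A n i j) (hsum : ∀ n i, ∑ j, A n i j = 1) {x : ℕ → ι → ℝ}
    (hx : ∀ t, x (t + 1) = (A t).mulVec (x t)) {t : ℕ} {C : ℝ} (hC : ∀ k, x t k ≤ C)
    (i : ι) (T : ℕ) :
    (∏ n ∈ Finset.Ico t (t + T), A n i i) * (C - x t i) ≤ C - x (t + T) i := by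
  have hbound : ∀ T k, x (t + T) k ≤ C := by
    intro T
    induction T with
    | zero => exact hC
    | succ T ih =>
      intro k
      have h := sub_mulVec_ge_diag_mul (hA (t + T)) (hsum (t + T)) ih k
      have h' := mul_nonneg (hA (t + T) k k) (sub_nonneg.2 (ih k))
      rw [← add_assoc, hx]
      linarith
  induction T with
  | zero => simp
  | succ T ih =>
    have h := sub_mulVec_ge_diag_mul (hA (t + T)) (hsum (t + T)) (hbound T) i
    have h' := mul_le_mul_of_nonneg_left ih (hA (t + T) i i)
    rw [← add_assoc, hx, Finset.prod_Ico_succ_top (Nat.le_add_right t T)]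
    linarith

/-- One-dimensional contraction bounds for products of row-stochastic matrices:
if `x_i^{(t)}` is a convex combination `p m^{(t)} + (1-p) M^{(t)}` of the current minimum and
maximum, then after `T` further steps `x_i^{(t+T)}` is bounded above (resp. below, in the
symmetric case) by the convex combination with coefficient `p ∏ A_{ii}^{(n)}`. -/
theorem one_dim_attention_bounds
    (N : ℕ) (hN : 1 ≤ N)
    (A : ℕ → Matrix (Fin N) (Fin N) ℝ)
    (hA_nonneg : ∀ n i j, 0 ≤ A n i j)
    (hA_rowsum : ∀ n i, ∑ j, A n i j = 1)
    (x : ℕ → Fin N → ℝ)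
    (hx : ∀ t, x (t + 1) = (A t).mulVec (x t))
    (i : Fin N) (t : ℕ) (p : ℝ) (hp0 : 0 ≤ p) (hp1 : p ≤ 1) :
    (x t i = p * (⨅ k, x t k) + (1 - p) * (⨆ k, x t k) →
      ∀ T : ℕ, 1 ≤ T →
        x (t + T) i ≤
          p * (∏ n ∈ Finset.Ico t (t + T), A n i i) * (⨅ k, x t k) +
            (1 - p * ∏ n ∈ Finset.Ico t (t + T), A n i i) * (⨆ k, x t k)) ∧
    (x t i = p * (⨆ k, x t k) + (1 - p) * (⨅ k, x t k) →
      ∀ T : ℕ, 1 ≤ T →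
        p * (∏ n ∈ Finset.Ico t (t + T), A n i i) * (⨆ k, x t k) +
            (1 - p * ∏ n ∈ Finset.Ico t (t + T), A n i i) * (⨅ k, x t k) ≤
          x (t + T) i) := by
  constructor
  · intro hi T _
    have h := prod_diag_mul_gap_le hA_nonneg hA_rowsum hx
      (fun k => le_ciSup (Set.finite_range (x t)).bddAbove k) i T
    rw [hi] at h
    linarith
  · intro hi T _
    have h := prod_diag_mul_gap_le (x := fun s => -x s) hA_nonneg hA_rowsum
      (fun s => by rw [hx, Matrix.mulVec_neg])
      (fun k => neg_le_neg (ciInf_le (Set.finite_range (x t)).bddBelow k)) i T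
    simp only [Pi.neg_apply] at h
    rw [hi] at h
    linarith
end

section
/- Let G be a quasi-strongly connected directed graph on {1,…,N} with self-loops and radius r, and let ε > 0. Let {A^{(n)}}_{n≥0} be row-stochastic N×N matrices, each ε-supported on G. For x^{(0)} ∈ ℝ^N define x^{(t+1)} = A^{(t)} x^{(t)}, and set m^{(t)} = min_i x_i^{(t)} and M^{(t)} = max_i x_i^{(t)}. Then for every t ≥ 0 and every k ∈ ℕ, M^{(t+kr)} − m^{(t+kr)} ≤ (1 − ε^r)^k (M^{(t)} − m^{(t)}). -/
/-- Directed paths of length exactly `m` in the graph with edge relation `E`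
(`E a b` means there is a directed edge from `a` to `b`). -/
def relPow {N : ℕ} (E : Fin N → Fin N → Prop) : ℕ → Fin N → Fin N → Prop
  | 0 => fun u v => u = v
  | m + 1 => fun u v => ∃ c, E u c ∧ relPow E m c v

/-- With self-loops, a path can be prolonged to any larger length. -/
theorem relPow_mono {N : ℕ} {E : Fin N → Fin N → Prop} (hloop : ∀ i, E i i)
    {u v : Fin N} {m n : ℕ} (hmn : m ≤ n) (h : relPow E m u v) : relPow E n u v := by
  induction hmn with
  | refl => exact h
  | step _ ih => exact ⟨u, hloop u, ih⟩

/-- A lower bound on the coordinates of the iterates propagates along paths: the excess of the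
starting coordinate over the bound is retained up to a factor `ε` per step. -/
theorem relPow_lower_bound {N : ℕ} {E : Fin N → Fin N → Prop} {ε : ℝ} (hε : 0 ≤ ε)
    {A : ℕ → Matrix (Fin N) (Fin N) ℝ}
    (hA_nonneg : ∀ n i j, 0 ≤ A n i j) (hA_rowsum : ∀ n i, ∑ j, A n i j = 1)
    (hA_supp : ∀ n i j, E j i → ε ≤ A n i j)
    {x : ℕ → Fin N → ℝ} (hx : ∀ t, x (t + 1) = (A t).mulVec (x t)) {a : ℝ} (n : ℕ) :
    ∀ (t : ℕ) (v u : Fin N), (∀ i, a ≤ x t i) → relPow E n v u →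
      ε ^ n * (x t v - a) ≤ x (t + n) u - a := by
  induction n with
  | zero =>
    rintro t v u - rfl
    simp
  | succ n ih =>
    rintro t v u ha ⟨c, hvc, hcu⟩
    have hstep : ∀ i, x (t + 1) i - a = ∑ j, A t i j * (x t j - a) := fun i => by
      simp [hx, Matrix.mulVec, dotProduct, mul_sub, ← Finset.sum_mul, hA_rowsum]
    have hterm : ∀ i j, 0 ≤ A t i j * (x t j - a) := fun i j =>
      mul_nonneg (hA_nonneg t i j) (sub_nonneg.2 (ha j))
    have hnext : ∀ i, a ≤ x (t + 1) i := fun i => by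
      rw [← sub_nonneg, hstep]
      exact Finset.sum_nonneg fun j _ => hterm i j
    have hc : ε * (x t v - a) ≤ x (t + 1) c - a := by
      rw [hstep]
      exact (mul_le_mul_of_nonneg_right (hA_supp t c v hvc) (sub_nonneg.2 (ha v))).trans
        (Finset.single_le_sum (fun j _ => hterm c j) (Finset.mem_univ v))
    calc ε ^ (n + 1) * (x t v - a) = ε ^ n * (ε * (x t v - a)) := by ring
      _ ≤ ε ^ n * (x (t + 1) c - a) := by gcongr
      _ ≤ x (t + 1 + n) u - a := ih (t + 1) c u hnext hcu
      _ = x (t + (n + 1)) u - a := by rw [add_assoc, add_comm 1 n]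

/-- For a quasi-strongly connected graph `G` with self-loops and radius `r`,
and row-stochastic matrices that are `ε`-supported on `G`, the oscillation `M - m` of the
iterates contracts by a factor `1 - ε^r` every `r` steps. -/
theorem oscillation_contraction
    (N : ℕ) (hN : 0 < N)
    (E : Fin N → Fin N → Prop)
    (hloop : ∀ i, E i i)
    (hqsc : ∃ v, ∀ u, ∃ m, relPow E m v u)
    (r : ℕ)
    (hradius : IsLeast {ρ : ℕ | ∃ v, ∀ u, ∃ m ≤ ρ, relPow E m v u} r)
    (ε : ℝ) (hε : 0 < ε)
    (A : ℕ → Matrix (Fin N) (Fin N) ℝ)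
    (hA_nonneg : ∀ n i j, 0 ≤ A n i j)
    (hA_rowsum : ∀ n i, ∑ j, A n i j = 1)
    (hA_supp : ∀ n i j, (E j i → ε ≤ A n i j) ∧ (¬ E j i → A n i j = 0))
    (x : ℕ → Fin N → ℝ)
    (hx : ∀ t, x (t + 1) = (A t).mulVec (x t)) :
    ∀ t k : ℕ,
      (⨆ i, x (t + k * r) i) - (⨅ i, x (t + k * r) i) ≤
        (1 - ε ^ r) ^ k * ((⨆ i, x t i) - (⨅ i, x t i)) := by
  obtain ⟨⟨v, hv⟩, -⟩ := hradius
  have hpath : ∀ u, relPow E r v u := fun u =>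
    let ⟨_, hm, h⟩ := hv u
    relPow_mono hloop hm h
  have : Nonempty (Fin N) := ⟨v⟩
  have hsupp : ∀ n i j, E j i → ε ≤ A n i j := fun n i j => (hA_supp n i j).1
  have hε_le : ε ≤ 1 := (hsupp 0 v v (hloop v)).trans <| hA_rowsum 0 v ▸
    Finset.single_le_sum (fun j _ => hA_nonneg 0 v j) (Finset.mem_univ v)
  have hx_neg : ∀ t, (-x) (t + 1) = (A t).mulVec ((-x) t) := fun t => by
    simp [hx, Matrix.mulVec_neg]
  have hcontract : ∀ t, (⨆ i, x (t + r) i) - (⨅ i, x (t + r) i) ≤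
      (1 - ε ^ r) * ((⨆ i, x t i) - (⨅ i, x t i)) := fun t => by
    have hlow : ∀ u, (⨅ i, x t i) + ε ^ r * (x t v - ⨅ i, x t i) ≤ x (t + r) u := fun u => by
      have h := relPow_lower_bound hε.le hA_nonneg hA_rowsum hsupp hx r t v u
        (fun i => ciInf_le (Set.finite_range (x t)).bddBelow i) (hpath u)
      linarith
    have hupp : ∀ u, x (t + r) u ≤ (⨆ i, x t i) - ε ^ r * ((⨆ i, x t i) - x t v) := fun u => by
      have h := relPow_lower_bound hε.le hA_nonneg hA_rowsum hsupp hx_neg r t v u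
        (fun i => neg_le_neg (le_ciSup (Set.finite_range (x t)).bddAbove i)) (hpath u)
      simp only [Pi.neg_apply] at h
      linarith
    linarith [ciSup_le hupp, le_ciInf hlow]
  intro t k
  induction k with
  | zero => simp
  | succ k ih =>
    have hfactor : 0 ≤ 1 - ε ^ r := sub_nonneg.2 (pow_le_one₀ hε.le hε_le)
    rw [Nat.succ_mul, ← add_assoc, pow_succ', mul_assoc]
    exact (hcontract _).trans (mul_le_mul_of_nonneg_left ih hfactor)
end

section
/- Let G be a quasi-strongly connected directed graph on {1,…,N} with self-loops and radius r, and let ε > 0. Let {A^{(n)}}_{n≥0} be row-stochastic N×N matrices, each ε-supported on G. For x^{(0)} ∈ ℝ^N define x^{(t+1)} = A^{(t)} x^{(t)}. Then there exists a constant C > 0 (depending on x^{(0)}) such that for all t ≥ 0, max_i x_i^{(t)} − min_i x_i^{(t)} ≤ C (1 − ε^r)^{t/r}; in particular one may take the bound (1 − ε^r)^{⌊t/r⌋} (max_i x_i^{(0)} − min_i x_i^{(0)}). -/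
theorem relPow_of_le {N : ℕ} {E : Fin N → Fin N → Prop} (hloop : ∀ i, E i i) {m k : ℕ}
    (hmk : m ≤ k) {u v : Fin N} (h : relPow E m u v) : relPow E k u v := by
  induction k, hmk using Nat.le_induction with
  | base => exact h
  | succ k _ ih => exact ⟨u, hloop u, ih⟩

theorem eq_of_relPow {N : ℕ} {E : Fin N → Fin N → Prop} (hE : ∀ i j, E i j → i = j) (m : ℕ)
    {u v : Fin N} (h : relPow E m u v) : u = v := by
  induction m generalizing u with
  | zero => exact h
  | succ m ih =>
    obtain ⟨c, hc, h⟩ := h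
    exact (hE _ _ hc).trans (ih h)

/-- One averaging step preserves lower bounds, and moves each vertex above the lower bound by at
least the weight of an in-neighbour times the excess of that neighbour. -/
theorem weight_mul_sub_le_mulVec_sub {N : ℕ} {A : Matrix (Fin N) (Fin N) ℝ}
    (hA_nonneg : ∀ i j, 0 ≤ A i j) (hA_rowsum : ∀ i, ∑ j, A i j = 1) {y : Fin N → ℝ} {b : ℝ}
    (hb : ∀ j, b ≤ y j) (i j : Fin N) : A i j * (y j - b) ≤ A.mulVec y i - b := by
  have h : A.mulVec y i - b = ∑ j, A i j * (y j - b) := by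
    simp [Matrix.mulVec, dotProduct, mul_sub, Finset.sum_sub_distrib, ← Finset.sum_mul, hA_rowsum]
  rw [h]
  exact Finset.single_le_sum (f := fun j => A i j * (y j - b))
    (fun j _ => mul_nonneg (hA_nonneg i j) (sub_nonneg.2 (hb j))) (Finset.mem_univ j)

theorem le_mulVec {N : ℕ} {A : Matrix (Fin N) (Fin N) ℝ}
    (hA_nonneg : ∀ i j, 0 ≤ A i j) (hA_rowsum : ∀ i, ∑ j, A i j = 1) {y : Fin N → ℝ} {b : ℝ}
    (hb : ∀ j, b ≤ y j) (i : Fin N) : b ≤ A.mulVec y i := by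
  have h := weight_mul_sub_le_mulVec_sub hA_nonneg hA_rowsum hb i i
  have := mul_nonneg (hA_nonneg i i) (sub_nonneg.2 (hb i))
  linarith

theorem pow_mul_sub_le_of_relPow {N : ℕ} {E : Fin N → Fin N → Prop} {ε : ℝ} (hε : 0 < ε)
    {A : ℕ → Matrix (Fin N) (Fin N) ℝ}
    (hA_nonneg : ∀ n i j, 0 ≤ A n i j) (hA_rowsum : ∀ n i, ∑ j, A n i j = 1)
    (hA_supp : ∀ n i j, E j i → ε ≤ A n i j)
    {x : ℕ → Fin N → ℝ} (hx : ∀ t, x (t + 1) = (A t).mulVec (x t)) {b : ℝ} (k : ℕ) {s : ℕ}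
    (hb : ∀ j, b ≤ x s j) {v u : Fin N} (h : relPow E k v u) :
    ε ^ k * (x s v - b) ≤ x (s + k) u - b := by
  induction k generalizing s v with
  | zero =>
    obtain rfl : v = u := h
    simp
  | succ k ih =>
    obtain ⟨c, hc, h⟩ := h
    have hb' : ∀ j, b ≤ x (s + 1) j := by
      rw [hx]
      exact le_mulVec (hA_nonneg s) (hA_rowsum s) hb
    have hstep : ε * (x s v - b) ≤ x (s + 1) c - b := by
      rw [hx]
      exact (mul_le_mul_of_nonneg_right (hA_supp s c v hc) (sub_nonneg.2 (hb v))).trans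
        (weight_mul_sub_le_mulVec_sub (hA_nonneg s) (hA_rowsum s) hb c v)
    calc ε ^ (k + 1) * (x s v - b) = ε ^ k * (ε * (x s v - b)) := by ring
      _ ≤ ε ^ k * (x (s + 1) c - b) := by gcongr
      _ ≤ x (s + 1 + k) u - b := ih hb' h
      _ = x (s + (k + 1)) u - b := by rw [add_right_comm, add_assoc]

theorem ciSup_sub_ciInf_le {ι : Type*} [Nonempty ι] {y : ι → ℝ} {d : ℝ}
    (h : ∀ i j, y i - y j ≤ d) : (⨆ i, y i) - (⨅ i, y i) ≤ d := by
  have h₁ : ∀ j, (⨆ i, y i) ≤ d + y j := fun j => ciSup_le fun i => by linarith [h i j]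
  have h₂ : (⨆ i, y i) - d ≤ ⨅ i, y i := le_ciInf fun j => by linarith [h₁ j]
  linarith

/-- If a vertex reaches every vertex in exactly `k` steps, then `k` averaging steps contract the
oscillation by the factor `1 - ε ^ k`. -/
theorem oscillation_add_le {N : ℕ} [Nonempty (Fin N)] {E : Fin N → Fin N → Prop} {ε : ℝ}
    (hε : 0 < ε) {A : ℕ → Matrix (Fin N) (Fin N) ℝ}
    (hA_nonneg : ∀ n i j, 0 ≤ A n i j) (hA_rowsum : ∀ n i, ∑ j, A n i j = 1)
    (hA_supp : ∀ n i j, E j i → ε ≤ A n i j)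
    {x : ℕ → Fin N → ℝ} (hx : ∀ t, x (t + 1) = (A t).mulVec (x t)) {k : ℕ} {v : Fin N}
    (hv : ∀ u, relPow E k v u) (s : ℕ) :
    (⨆ i, x (s + k) i) - (⨅ i, x (s + k) i) ≤
      (1 - ε ^ k) * ((⨆ i, x s i) - (⨅ i, x s i)) := by
  refine ciSup_sub_ciInf_le fun i j => ?_
  have hlow := pow_mul_sub_le_of_relPow hε hA_nonneg hA_rowsum hA_supp hx k
    (ciInf_le (Set.finite_range (x s)).bddBelow) (hv j)
  have hup := pow_mul_sub_le_of_relPow (x := fun t => -x t) hε hA_nonneg hA_rowsum hA_supp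
    (fun t => by rw [hx, Matrix.mulVec_neg]) k
    (fun l => neg_le_neg (le_ciSup (Set.finite_range (x s)).bddAbove l)) (hv i)
  simp only [Pi.neg_apply] at hup
  linarith

theorem oscillation_antitone {N : ℕ} [Nonempty (Fin N)] {A : ℕ → Matrix (Fin N) (Fin N) ℝ}
    (hA_nonneg : ∀ n i j, 0 ≤ A n i j) (hA_rowsum : ∀ n i, ∑ j, A n i j = 1)
    {x : ℕ → Fin N → ℝ} (hx : ∀ t, x (t + 1) = (A t).mulVec (x t)) :
    Antitone fun t => (⨆ i, x t i) - (⨅ i, x t i) := by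
  refine antitone_nat_of_succ_le fun s => ciSup_sub_ciInf_le fun i j => ?_
  have hlow := le_mulVec (hA_nonneg s) (hA_rowsum s)
    (ciInf_le (Set.finite_range (x s)).bddBelow) j
  have hup := le_mulVec (y := -x s) (hA_nonneg s) (hA_rowsum s)
    (fun l => neg_le_neg (le_ciSup (Set.finite_range (x s)).bddAbove l)) i
  rw [Matrix.mulVec_neg, Pi.neg_apply] at hup
  rw [hx]
  linarith

/-- For a quasi-strongly connected graph `G` with self-loops and radius `r`,
and row-stochastic matrices `ε`-supported on `G`, the oscillation of the iterates decays
exponentially: there is `C > 0` with `M^{(t)} - m^{(t)} ≤ C (1-ε^r)^{t/r}`; in particular one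
may take the bound `(1-ε^r)^{⌊t/r⌋} (M^{(0)} - m^{(0)})`. -/
theorem oscillation_exponential_decay
    (N : ℕ) (hN : 0 < N)
    (E : Fin N → Fin N → Prop)
    (hloop : ∀ i, E i i)
    (hqsc : ∃ v, ∀ u, ∃ m, relPow E m v u)
    (r : ℕ)
    (hradius : IsLeast {ρ : ℕ | ∃ v, ∀ u, ∃ m ≤ ρ, relPow E m v u} r)
    (ε : ℝ) (hε : 0 < ε)
    (A : ℕ → Matrix (Fin N) (Fin N) ℝ)
    (hA_nonneg : ∀ n i j, 0 ≤ A n i j)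
    (hA_rowsum : ∀ n i, ∑ j, A n i j = 1)
    (hA_supp : ∀ n i j, (E j i → ε ≤ A n i j) ∧ (¬ E j i → A n i j = 0))
    (x : ℕ → Fin N → ℝ)
    (hx : ∀ t, x (t + 1) = (A t).mulVec (x t)) :
    (∃ C > 0, ∀ t : ℕ,
      (⨆ i, x t i) - (⨅ i, x t i) ≤ C * (1 - ε ^ r) ^ ((t : ℝ) / (r : ℝ))) ∧
    (∀ t : ℕ,
      (⨆ i, x t i) - (⨅ i, x t i) ≤
        (1 - ε ^ r) ^ (t / r) * ((⨆ i, x 0 i) - (⨅ i, x 0 i))) := by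
  have : Nonempty (Fin N) := ⟨⟨0, hN⟩⟩
  have hA_edge : ∀ n i j, E j i → ε ≤ A n i j := fun n i j => (hA_supp n i j).1
  obtain ⟨⟨v, hv⟩, hmin⟩ := hradius
  have hv' : ∀ u, relPow E r v u := fun u => by
    obtain ⟨m, hm, h⟩ := hv u
    exact relPow_of_le hloop hm h
  have hε1 : ε ≤ 1 := by
    rw [← hA_rowsum 0 v]
    exact (hA_edge 0 v v (hloop v)).trans
      (Finset.single_le_sum (fun j _ => hA_nonneg 0 v j) (Finset.mem_univ v))
  have hq0 : 0 ≤ 1 - ε ^ r := sub_nonneg.2 (pow_le_one₀ hε.le hε1)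
  have hq1 : 1 - ε ^ r ≤ 1 := sub_le_self _ (by positivity)
  set osc : ℕ → ℝ := fun t => (⨆ i, x t i) - (⨅ i, x t i)
  have hanti : Antitone osc := oscillation_antitone hA_nonneg hA_rowsum hx
  have hosc0 : 0 ≤ osc 0 :=
    sub_nonneg.2 (ciInf_le_ciSup (Set.finite_range _).bddBelow (Set.finite_range _).bddAbove)
  have hmul : ∀ n, osc (r * n) ≤ (1 - ε ^ r) ^ n * osc 0 := fun n => by
    induction n with
    | zero => simp
    | succ n ih =>
      calc osc (r * n + r) ≤ (1 - ε ^ r) * osc (r * n) :=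
            oscillation_add_le hε hA_nonneg hA_rowsum hA_edge hx hv' (r * n)
        _ ≤ (1 - ε ^ r) * ((1 - ε ^ r) ^ n * osc 0) := by gcongr
        _ = (1 - ε ^ r) ^ (n + 1) * osc 0 := by ring
  have hfloor : ∀ t, osc t ≤ (1 - ε ^ r) ^ (t / r) * osc 0 := fun t =>
    (hanti (Nat.mul_div_le t r)).trans (hmul _)
  refine ⟨?_, hfloor⟩
  rcases Nat.eq_zero_or_pos r with rfl | hr
  · refine ⟨osc 0 + 1, by positivity, fun t => ?_⟩
    have := hanti (Nat.zero_le t)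
    simp only [Nat.cast_zero, div_zero, Real.rpow_zero]
    change osc t ≤ _
    linarith
  have hεlt : ε < 1 := by
    refine lt_of_le_of_ne hε1 fun h1 => hr.ne' (Nat.le_zero.1 (hmin ⟨v, fun u => ⟨0, le_rfl, ?_⟩⟩))
    refine eq_of_relPow (fun i j hij => ?_) r (hv' u)
    by_contra hne
    have hpair := Finset.sum_le_sum_of_subset_of_nonneg (Finset.subset_univ {i, j})
      (fun l _ _ => hA_nonneg 0 j l)
    rw [Finset.sum_pair hne, hA_rowsum] at hpair
    linarith [hA_edge 0 j i hij, hA_edge 0 j j (hloop j)]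
  have hq : 0 < 1 - ε ^ r := sub_pos.2 (pow_lt_one₀ hε.le hεlt hr.ne')
  refine ⟨osc 0 / (1 - ε ^ r) + 1, by positivity, fun t => ?_⟩
  have hexp : (t : ℝ) / r - 1 ≤ ((t / r : ℕ) : ℝ) := by
    rw [← Nat.floor_div_eq_div (K := ℝ)]
    exact (Nat.sub_one_lt_floor _).le
  have hpow : (1 - ε ^ r) ^ (t / r) ≤ (1 - ε ^ r) ^ ((t : ℝ) / r) / (1 - ε ^ r) := by
    rw [← Real.rpow_natCast, ← Real.rpow_sub_one hq.ne']
    exact Real.rpow_le_rpow_of_exponent_ge hq hq1 hexp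
  calc osc t ≤ (1 - ε ^ r) ^ (t / r) * osc 0 := hfloor t
    _ ≤ (1 - ε ^ r) ^ ((t : ℝ) / r) / (1 - ε ^ r) * osc 0 := by gcongr
    _ = osc 0 / (1 - ε ^ r) * (1 - ε ^ r) ^ ((t : ℝ) / r) := by ring
    _ ≤ (osc 0 / (1 - ε ^ r) + 1) * (1 - ε ^ r) ^ ((t : ℝ) / r) := by
      gcongr
      linarith
end

section
/- Let N ≤ d and let X^{(0)} ∈ ℝ^{N×d} have rank N with all rows of unit Euclidean norm. Consider the LayerNorm self-attention dynamics X^{(t+1)} = D^{(t)} A^{(t)} X^{(t)} W^{(t)}, where each A^{(t)} ∈ ℝ^{N×N} is row-stochastic, each W^{(t)} ∈ ℝ^{d×d} is orthogonal, and D^{(t)} is the diagonal matrix with D^{(t)}_{ii} = 1 / ‖(A^{(t)} X^{(t)} W^{(t)})_{i,:}‖₂. Then the dynamics is well-defined (each row (A^{(t)} X^{(t)} W^{(t)})_{i,:} is nonzero), and there exist constants C₁, C₂ > 0 such that C₁ ≤ D^{(t)}_{ii} ≤ C₂ for all t ≥ 0 and all i ∈ {1,…,N}; in fact one can take C₁ =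 1 and C₂ = 1/γ, where γ = min{‖x‖₂ : x in the convex hull of the rows of X^{(0)}} > 0. -/
open Matrix

theorem sqrt_sum_sq_eq_norm_toLp {d : ℕ} (v : Fin d → ℝ) :
    Real.sqrt (∑ k, v k ^ 2) = ‖WithLp.toLp 2 v‖ := by
  simp [EuclideanSpace.norm_eq]

theorem sum_sq_row_mul_orthogonal {m d : ℕ} (M : Matrix (Fin m) (Fin d) ℝ)
    {Q : Matrix (Fin d) (Fin d) ℝ} (hQ : Q * Qᵀ = 1) (i : Fin m) :
    ∑ k, (M * Q) i k ^ 2 = ∑ k, M i k ^ 2 := by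
  have key : ∀ B : Matrix (Fin m) (Fin d) ℝ, ∑ k, B i k ^ 2 = (B * Bᵀ) i i := fun B => by
    simp [mul_apply, sq]
  have h : M * Q * (M * Q)ᵀ = M * Mᵀ := by
    rw [transpose_mul, Matrix.mul_assoc, ← Matrix.mul_assoc Q, hQ, Matrix.one_mul]
  rw [key, key, h]

theorem sqrt_sum_sq_vecMul_le_one {m d : ℕ} (Y : Matrix (Fin m) (Fin d) ℝ)
    (hY : ∀ j, ∑ k, Y j k ^ 2 = 1) {a : Fin m → ℝ} (ha : a ∈ stdSimplex ℝ (Fin m)) :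
    Real.sqrt (∑ k, (a ᵥ* Y) k ^ 2) ≤ 1 := by
  have h : WithLp.toLp 2 (a ᵥ* Y) = ∑ j, a j • WithLp.toLp 2 (Y j) := by
    ext k
    simp [vecMul, dotProduct]
  rw [sqrt_sum_sq_eq_norm_toLp, h]
  refine (norm_sum_le _ _).trans ?_
  rw [← ha.2]
  refine Finset.sum_le_sum fun j _ => ?_
  rw [norm_smul, ← sqrt_sum_sq_eq_norm_toLp, hY, Real.sqrt_one, mul_one,
    Real.norm_of_nonneg (ha.1 j)]

theorem convexHull_range_row_eq {m d : ℕ} (Y : Matrix (Fin m) (Fin d) ℝ) :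
    convexHull ℝ (Set.range fun i => Y i) = (fun w => w ᵥ* Y) '' stdSimplex ℝ (Fin m) := by
  rw [← convexHull_basis_eq_stdSimplex]
  have h := (vecMulLinear Y).image_convexHull
    (Set.range fun i j : Fin m => if i = j then (1 : ℝ) else 0)
  simp only [coe_vecMulLinear] at h
  rw [h, ← Set.range_comp]
  congr 2
  ext i k
  simp [vecMul, dotProduct]

/-- The distance from the origin to the convex hull of the rows of a matrix. -/
noncomputable def rowHullDist {m d : ℕ} (Y : Matrix (Fin m) (Fin d) ℝ) : ℝ :=
  sInf {s : ℝ | ∃ x ∈ convexHull ℝ (Set.range fun i => Y i), Real.sqrt (∑ k, (x k) ^ 2) = s}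

theorem rowHullDist_pos {m d : ℕ} (hm : 0 < m) (Y : Matrix (Fin m) (Fin d) ℝ)
    (hY : Y.rank = m) : 0 < rowHullDist Y := by
  have hli : LinearIndependent ℝ Y.row := by
    rw [linearIndependent_iff_card_eq_finrank_span, Fintype.card_fin, Set.finrank,
      ← rank_eq_finrank_span_row, hY]
  have hcomp : IsCompact {s : ℝ | ∃ x ∈ convexHull ℝ (Set.range fun i => Y i),
      Real.sqrt (∑ k, (x k) ^ 2) = s} :=
    (Set.finite_range _).isCompact_convexHull (𝕜 := ℝ) |>.image
      (f := fun x : Fin d → ℝ => Real.sqrt (∑ k, (x k) ^ 2)) (by fun_prop)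
  obtain ⟨x, hx, hxs⟩ := hcomp.sInf_mem
    ⟨_, Y ⟨0, hm⟩, subset_convexHull ℝ _ ⟨_, rfl⟩, rfl⟩
  rw [rowHullDist, ← hxs, sqrt_sum_sq_eq_norm_toLp, norm_pos_iff]
  rw [convexHull_range_row_eq] at hx
  obtain ⟨w, hw, rfl⟩ := hx
  intro h0
  have hw0 : w = 0 := by
    refine vecMul_injective_iff.2 hli ?_
    simpa using h0
  simpa [hw0] using hw.2

theorem rowHullDist_le_of_one_le_sum {m d : ℕ} (Y : Matrix (Fin m) (Fin d) ℝ)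
    {c : Fin m → ℝ} (hc : ∀ j, 0 ≤ c j) (hsum : 1 ≤ ∑ j, c j) :
    rowHullDist Y ≤ Real.sqrt (∑ k, (c ᵥ* Y) k ^ 2) := by
  set s := ∑ j, c j
  have hs : 0 < s := by linarith
  have hmem : s⁻¹ • c ∈ stdSimplex ℝ (Fin m) := by
    refine ⟨fun j => mul_nonneg (by positivity) (hc j), ?_⟩
    simp only [Pi.smul_apply, smul_eq_mul, ← Finset.mul_sum]
    exact inv_mul_cancel₀ hs.ne'
  have h1 : rowHullDist Y ≤ Real.sqrt (∑ k, ((s⁻¹ • c) ᵥ* Y) k ^ 2) := by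
    refine csInf_le ⟨0, ?_⟩ ⟨_, ?_, rfl⟩
    · rintro _ ⟨x, -, rfl⟩
      positivity
    · rw [convexHull_range_row_eq]
      exact ⟨_, hmem, rfl⟩
  refine h1.trans ?_
  rw [sqrt_sum_sq_eq_norm_toLp, sqrt_sum_sq_eq_norm_toLp, smul_vecMul, WithLp.toLp_smul,
    norm_smul, Real.norm_of_nonneg (by positivity)]
  exact mul_le_of_le_one_left (norm_nonneg _) (inv_le_one_of_one_le₀ hsum)

/-- `X` is obtained from `Y` by a rotation and by nonnegative row combinations of total weight
at least one, and has unit rows. -/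
def IsUnitRowExpansion {m d : ℕ} (Y X : Matrix (Fin m) (Fin d) ℝ) : Prop :=
  (∀ i, ∑ k, X i k ^ 2 = 1) ∧
    ∃ (P : Matrix (Fin m) (Fin m) ℝ) (Q : Matrix (Fin d) (Fin d) ℝ),
      (∀ i j, 0 ≤ P i j) ∧ (∀ i, 1 ≤ ∑ j, P i j) ∧ Q * Qᵀ = 1 ∧ X = P * Y * Q

theorem mul_nonneg_one_le_rowsum {m : ℕ} {A P : Matrix (Fin m) (Fin m) ℝ}
    (hA : ∀ i, A i ∈ stdSimplex ℝ (Fin m)) (hP : ∀ i j, 0 ≤ P i j)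
    (hP1 : ∀ i, 1 ≤ ∑ j, P i j) :
    (∀ i j, 0 ≤ (A * P) i j) ∧ ∀ i, 1 ≤ ∑ j, (A * P) i j := by
  simp only [mul_apply]
  refine ⟨fun i j => Finset.sum_nonneg fun l _ => mul_nonneg ((hA i).1 l) (hP l j), fun i => ?_⟩
  rw [Finset.sum_comm, ← (hA i).2]
  refine Finset.sum_le_sum fun l _ => ?_
  rw [← Finset.mul_sum]
  exact le_mul_of_one_le_right ((hA i).1 l) (hP1 l)

theorem mul_mul_orthogonal_mul_transpose {d : ℕ} {Q W : Matrix (Fin d) (Fin d) ℝ}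
    (hQ : Q * Qᵀ = 1) (hW : W * Wᵀ = 1) : Q * W * (Q * W)ᵀ = 1 := by
  rw [transpose_mul, Matrix.mul_assoc, ← Matrix.mul_assoc W, hW, Matrix.one_mul, hQ]

theorem IsUnitRowExpansion.scaling_bounds {m d : ℕ} {Y X : Matrix (Fin m) (Fin d) ℝ}
    (h : IsUnitRowExpansion Y X) {A : Matrix (Fin m) (Fin m) ℝ}
    (hA : ∀ i, A i ∈ stdSimplex ℝ (Fin m)) {W : Matrix (Fin d) (Fin d) ℝ}
    (hW : W * Wᵀ = 1) (i : Fin m) :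
    rowHullDist Y ≤ Real.sqrt (∑ k, (A * X * W) i k ^ 2) ∧
      Real.sqrt (∑ k, (A * X * W) i k ^ 2) ≤ 1 := by
  obtain ⟨hX, P, Q, hP, hP1, hQ, rfl⟩ := h
  constructor
  · have e : A * (P * Y * Q) * W = A * P * Y * (Q * W) := by simp only [Matrix.mul_assoc]
    rw [e, sum_sq_row_mul_orthogonal _ (mul_mul_orthogonal_mul_transpose hQ hW)]
    obtain ⟨h0, h1⟩ := mul_nonneg_one_le_rowsum hA hP hP1
    exact rowHullDist_le_of_one_le_sum Y (h0 i) (h1 i)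
  · rw [sum_sq_row_mul_orthogonal _ hW]
    exact sqrt_sum_sq_vecMul_le_one _ hX (hA i)

theorem IsUnitRowExpansion.normalized {m d : ℕ} {Y X X' : Matrix (Fin m) (Fin d) ℝ}
    (h : IsUnitRowExpansion Y X) (hY : 0 < rowHullDist Y) {A : Matrix (Fin m) (Fin m) ℝ}
    (hA : ∀ i, A i ∈ stdSimplex ℝ (Fin m)) {W : Matrix (Fin d) (Fin d) ℝ}
    (hW : W * Wᵀ = 1)
    (hX' : ∀ i j, X' i j = (A * X * W) i j / Real.sqrt (∑ k, (A * X * W) i k ^ 2)) :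
    IsUnitRowExpansion Y X' := by
  have hb := h.scaling_bounds hA hW
  have hpos : ∀ i, 0 < Real.sqrt (∑ k, (A * X * W) i k ^ 2) := fun i => hY.trans_le (hb i).1
  obtain ⟨-, P, Q, hP, hP1, hQ, rfl⟩ := h
  obtain ⟨h0, h1⟩ := mul_nonneg_one_le_rowsum hA hP hP1
  refine ⟨fun i => ?_,
    diagonal (fun i => (Real.sqrt (∑ k, (A * (P * Y * Q) * W) i k ^ 2))⁻¹) * (A * P), Q * W,
    fun i j => ?_, fun i => ?_, mul_mul_orthogonal_mul_transpose hQ hW, ?_⟩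
  · simp only [hX', div_pow]
    rw [← Finset.sum_div, Real.sq_sqrt (by positivity)]
    exact div_self (Real.sqrt_pos.1 (hpos i)).ne'
  · rw [diagonal_mul]
    exact mul_nonneg (inv_nonneg.2 (hpos i).le) (h0 i j)
  · simp only [diagonal_mul, ← Finset.mul_sum]
    exact one_le_mul_of_one_le_of_one_le ((one_le_inv₀ (hpos i)).2 (hb i).2) (h1 i)
  · have e : ∀ D : Matrix (Fin m) (Fin m) ℝ,
        D * (A * P) * Y * (Q * W) = D * (A * (P * Y * Q) * W) := fun D => by
      simp only [Matrix.mul_assoc]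
    ext i j
    rw [e, diagonal_mul, hX', div_eq_inv_mul]


/-- For the LayerNorm self-attention dynamics
`X^{(t+1)} = D^{(t)} A^{(t)} X^{(t)} W^{(t)}` with row-stochastic `A^{(t)}`, orthogonal
`W^{(t)}`, `N ≤ d`, and full-rank unit-row initial condition: the dynamics is well-defined and
the LayerNorm scaling factors `D^{(t)}_{ii}` are bounded between two positive constants; in
fact one can take `C₁ = 1` and `C₂ = 1/γ`, where `γ > 0` is the minimum norm over the convex
hull of the rows of `X^{(0)}`. -/
theorem layernorm_scaling_bounded
    (N d : ℕ) (hN : 0 < N) (hNd : N ≤ d)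
    (X : ℕ → Matrix (Fin N) (Fin d) ℝ)
    (hrank : (X 0).rank = N)
    (hunit : ∀ i, ∑ k, (X 0 i k) ^ 2 = 1)
    (A : ℕ → Matrix (Fin N) (Fin N) ℝ)
    (hA_nonneg : ∀ t i j, 0 ≤ A t i j)
    (hA_rowsum : ∀ t i, ∑ j, A t i j = 1)
    (W : ℕ → Matrix (Fin d) (Fin d) ℝ)
    (hW : ∀ t, W t * (W t).transpose = 1)
    (hX : ∀ t i j,
      X (t + 1) i j =
        (A t * X t * W t) i j / Real.sqrt (∑ k, ((A t * X t * W t) i k) ^ 2)) :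
    (∀ t i, (fun k => (A t * X t * W t) i k) ≠ 0) ∧
    (∃ C₁ C₂ : ℝ, 0 < C₁ ∧ 0 < C₂ ∧ ∀ t i,
      C₁ ≤ 1 / Real.sqrt (∑ k, ((A t * X t * W t) i k) ^ 2) ∧
      1 / Real.sqrt (∑ k, ((A t * X t * W t) i k) ^ 2) ≤ C₂) ∧
    (0 < sInf {s : ℝ | ∃ x ∈ convexHull ℝ (Set.range fun i => X 0 i),
        Real.sqrt (∑ k, (x k) ^ 2) = s} ∧
      ∀ t i,
        1 ≤ 1 / Real.sqrt (∑ k, ((A t * X t * W t) i k) ^ 2) ∧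
        1 / Real.sqrt (∑ k, ((A t * X t * W t) i k) ^ 2) ≤
          1 / sInf {s : ℝ | ∃ x ∈ convexHull ℝ (Set.range fun i => X 0 i),
            Real.sqrt (∑ k, (x k) ^ 2) = s}) := by
  have hγ : 0 < rowHullDist (X 0) := rowHullDist_pos hN _ hrank
  have hA : ∀ t i, A t i ∈ stdSimplex ℝ (Fin N) := fun t i => ⟨hA_nonneg t i, hA_rowsum t i⟩
  have hinv : ∀ t, IsUnitRowExpansion (X 0) (X t) := by
    intro t
    induction t with
    | zero =>
      exact ⟨hunit, 1, 1, fun i j => by rw [one_apply]; split_ifs <;> norm_num,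
        fun i => by simp [one_apply], by simp, by simp⟩
    | succ t ih => exact ih.normalized hγ (hA t) (hW t) (hX t)
  have hb := fun t => (hinv t).scaling_bounds (hA t) (hW t)
  have hbounds : ∀ t i,
      1 ≤ 1 / Real.sqrt (∑ k, ((A t * X t * W t) i k) ^ 2) ∧
      1 / Real.sqrt (∑ k, ((A t * X t * W t) i k) ^ 2) ≤ 1 / rowHullDist (X 0) := fun t i =>
    ⟨(one_le_div (hγ.trans_le (hb t i).1)).2 (hb t i).2, one_div_le_one_div_of_le hγ (hb t i).1⟩
  refine ⟨fun t i h => ?_, ⟨1, 1 / rowHullDist (X 0), one_pos, one_div_pos.2 hγ, hbounds⟩,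
    hγ, hbounds⟩
  refine (hγ.trans_le (hb t i).1).ne' ?_
  simp [fun k => show (A t * X t * W t) i k = 0 from congrFun h k]
end

section
/- (Corollary 1) Let G be a quasi-strongly connected directed graph on {1,…,N} with self-loops and radius r. Consider the LayerNorm self-attention dynamics X^{(t+1)} = D^{(t)} A^{(t)} X^{(t)} W_V^{(t)}, where A^{(t)} is the masked-softmax attention matrix of X^{(t)} over G with weights W_Q^{(t)}, W_K^{(t)} satisfying max(‖W_Q^{(t)}‖₂, ‖W_K^{(t)}‖₂) ≤ C₀ for all t, each W_V^{(t)} ∈ ℝ^{d×d} is orthogonal, and D^{(t)} is diagonal with D^{(t)}_{ii} = 1/‖(A^{(t)} X^{(t)} W_V^{(t)})_{i,:}‖₂. Assume X^{(0)} has unit-norm rows and φ^{(0)} := min_{i,j∈{1,…,N}} ⟨X^{(0)}_{i,:}, X^{(0)}_{j,:}⟩ ≥ 0. Then the dynamics is well-defined, and there exist C > 0 and ε > 0 with Nε < 1 such that μ(X^{(t)}) ≤ C (1 − ε^{2r})^{t/(2r)} for all t ≥ 0; hence the tokens converge exponentially to a common point on the unit sphere 𝕊^{d−1}. -/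
/-- The Frobenius norm of a real matrix. -/
noncomputable def frobNorm {N d : ℕ} (M : Matrix (Fin N) (Fin d) ℝ) : ℝ :=
  Real.sqrt (∑ i, ∑ j, (M i j) ^ 2)

/-- The token-similarity measure `μ(X) = ‖X - 𝟙 (𝟙ᵀ X / N)‖_F`. -/
noncomputable def muMeasure {N d : ℕ} (X : Matrix (Fin N) (Fin d) ℝ) : ℝ :=
  frobNorm (X - Matrix.of fun _ j => (∑ k, X k j) / N)

/-- The spectral (operator `2`-) norm of a real matrix. -/
noncomputable def specNorm {n m : ℕ} (M : Matrix (Fin n) (Fin m) ℝ) : ℝ :=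
  ‖LinearMap.toContinuousLinearMap (Matrix.toEuclideanLin M)‖

/-- The masked-softmax attention matrix over the graph with edge relation `E`
(`E j i` means token `i` may attend to token `j`), given raw scores `R`. -/
noncomputable def maskedAttn {N : ℕ} (E : Fin N → Fin N → Prop) [DecidableRel E]
    (R : Matrix (Fin N) (Fin N) ℝ) : Matrix (Fin N) (Fin N) ℝ :=
  Matrix.of fun i j =>
    if E j i then
      Real.exp (R i j) / ∑ k ∈ Finset.univ.filter (fun k => E k i), Real.exp (R i k)
    else 0

open Matrix Finset

theorem relPow_mono_of_refl {N : ℕ} {E : Fin N → Fin N → Prop} (hloop : ∀ i, E i i)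
    {m n : ℕ} (h : m ≤ n) {u v : Fin N} (hm : relPow E m u v) : relPow E n u v := by
  induction h with
  | refl => exact hm
  | step _ ih => exact ⟨u, hloop u, ih⟩

theorem abs_apply_le_specNorm {n m : ℕ} (M : Matrix (Fin n) (Fin m) ℝ) (i : Fin n) (j : Fin m) :
    |M i j| ≤ specNorm M := by
  have h := (LinearMap.toContinuousLinearMap (Matrix.toEuclideanLin M)).le_opNorm
    (EuclideanSpace.single j (1 : ℝ))
  have h2 := PiLp.norm_apply_le ((Matrix.toEuclideanLin M) (EuclideanSpace.single j (1 : ℝ))) i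
  simp only [LinearMap.coe_toContinuousLinearMap', PiLp.norm_single, norm_one,
    mul_one] at h
  have h3 : (Matrix.toEuclideanLin M) (EuclideanSpace.single j (1 : ℝ)) i = M i j := by
    simp [Matrix.toLpLin_apply]
  rw [h3, Real.norm_eq_abs] at h2
  exact h2.trans h

theorem abs_sum_le_card_mul {n : ℕ} {f : Fin n → ℝ} {B : ℝ} (h : ∀ i, |f i| ≤ B) :
    |∑ i, f i| ≤ n * B := by
  calc |∑ i, f i| ≤ ∑ i, |f i| := abs_sum_le_sum_abs _ _
    _ ≤ ∑ _i : Fin n, B := sum_le_sum fun i _ => h i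
    _ = n * B := by simp

theorem abs_attention_score_le {N d : ℕ} {X : Matrix (Fin N) (Fin d) ℝ}
    {WQ WK : Matrix (Fin d) (Fin d) ℝ} {C : ℝ} (hX : ∀ i k, |X i k| ≤ 1)
    (hQ : specNorm WQ ≤ C) (hK : specNorm WK ≤ C) (i j : Fin N) :
    |((Real.sqrt d)⁻¹ • (X * WQ * (X * WK).transpose)) i j| ≤
      (Real.sqrt d)⁻¹ * (d * ((d * C) * (d * C))) := by
  have hentry : ∀ W : Matrix (Fin d) (Fin d) ℝ, specNorm W ≤ C →
      ∀ i k, |(X * W) i k| ≤ d * C := by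
    intro W hW i k
    rw [Matrix.mul_apply]
    refine abs_sum_le_card_mul fun a => ?_
    rw [abs_mul]
    have h1 := (abs_apply_le_specNorm W a k).trans hW
    calc |X i a| * |W a k| ≤ 1 * C := mul_le_mul (hX i a) h1 (abs_nonneg _) zero_le_one
      _ = C := one_mul C
  rw [Matrix.smul_apply, smul_eq_mul, abs_mul, abs_of_nonneg (inv_nonneg.2 (Real.sqrt_nonneg _))]
  refine mul_le_mul_of_nonneg_left ?_ (inv_nonneg.2 (Real.sqrt_nonneg _))
  rw [Matrix.mul_apply]
  refine abs_sum_le_card_mul fun k => ?_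
  rw [abs_mul, Matrix.transpose_apply]
  have h1 := hentry WQ hQ i k
  exact mul_le_mul h1 (hentry WK hK j k) (abs_nonneg _) ((abs_nonneg _).trans h1)

section MaskedAttention

variable {N : ℕ} {E : Fin N → Fin N → Prop} [DecidableRel E] (R : Matrix (Fin N) (Fin N) ℝ)

theorem maskedAttn_nonneg (i j : Fin N) : 0 ≤ maskedAttn E R i j := by
  simp only [maskedAttn, Matrix.of_apply]
  split_ifs
  · exact div_nonneg (Real.exp_pos _).le (sum_nonneg fun _ _ => (Real.exp_pos _).le)
  · exact le_rfl

theorem sum_maskedAttn (hloop : ∀ i, E i i) (i : Fin N) : ∑ j, maskedAttn E R i j = 1 := by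
  simp only [maskedAttn, Matrix.of_apply]
  rw [← sum_filter, ← sum_div]
  exact div_self (sum_pos (fun _ _ => Real.exp_pos _) ⟨i, by simp [hloop]⟩).ne'

theorem le_maskedAttn {B : ℝ} (hR : ∀ i j, |R i j| ≤ B) {i j : Fin N} (h : E j i) :
    Real.exp (-(2 * B)) / (N + 1) ≤ maskedAttn E R i j := by
  simp only [maskedAttn, Matrix.of_apply, if_pos h]
  have hpos : 0 < ∑ k ∈ univ.filter (fun k => E k i), Real.exp (R i k) :=
    sum_pos (fun _ _ => Real.exp_pos _) ⟨j, by simp [h]⟩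
  have hle : ∑ k ∈ univ.filter (fun k => E k i), Real.exp (R i k) ≤ (N + 1) * Real.exp B := by
    calc ∑ k ∈ univ.filter (fun k => E k i), Real.exp (R i k)
        ≤ ∑ k, Real.exp (R i k) :=
          sum_le_sum_of_subset_of_nonneg (filter_subset _ _) fun _ _ _ => (Real.exp_pos _).le
      _ ≤ ∑ _k : Fin N, Real.exp B :=
          sum_le_sum fun k _ => Real.exp_le_exp.2 ((abs_le.1 (hR i k)).2)
      _ = N * Real.exp B := by simp
      _ ≤ (N + 1) * Real.exp B := by nlinarith [Real.exp_pos B]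
  rw [div_le_div_iff₀ (by positivity) hpos]
  calc Real.exp (-(2 * B)) * ∑ k ∈ univ.filter (fun k => E k i), Real.exp (R i k)
      ≤ Real.exp (-(2 * B)) * ((N + 1) * Real.exp B) :=
        mul_le_mul_of_nonneg_left hle (Real.exp_pos _).le
    _ = Real.exp (-B) * (N + 1) := by
        rw [show -B = -(2 * B) + B by ring, Real.exp_add]; ring
    _ ≤ Real.exp (R i j) * (N + 1) := by
        have := Real.exp_le_exp.2 ((abs_le.1 (hR i j)).1)
        gcongr

end MaskedAttention

theorem mul_mul_transpose_apply {N : ℕ} (P G : Matrix (Fin N) (Fin N) ℝ) (i j : Fin N) :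
    (P * G * P.transpose) i j = ∑ k, ∑ l, P i k * P j l * G k l := by
  simp only [Matrix.mul_apply, Matrix.transpose_apply, sum_mul]
  rw [sum_comm]
  exact sum_congr rfl fun k _ => sum_congr rfl fun l _ => by ring

/-- A nonnegative congruence of a Gram matrix of unit vectors that keeps the diagonal equal to one
and gives weight at least `δ` to a common index `v` pushes the minimal entry towards one. -/
theorem le_congruence_apply {N : ℕ} {P G : Matrix (Fin N) (Fin N) ℝ} {φ δ : ℝ} {v : Fin N}
    (hP : ∀ i k, 0 ≤ P i k) (hδ : 0 ≤ δ) (hPv : ∀ i, δ ≤ P i v)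
    (hφ : 0 ≤ φ) (hG : ∀ k l, φ ≤ G k l) (hG1 : ∀ k l, G k l ≤ 1) (hGv : G v v = 1)
    (hdiag : ∀ i, (P * G * P.transpose) i i = 1) (i j : Fin N) :
    φ + δ ^ 2 * (1 - φ) ≤ (P * G * P.transpose) i j := by
  have hsum : ∀ i, 1 ≤ ∑ k, P i k := by
    intro i
    have h0 : 0 ≤ ∑ k, P i k := sum_nonneg fun k _ => hP i k
    have h1 : 1 ≤ (∑ k, P i k) * ∑ l, P i l := by
      rw [← hdiag i, mul_mul_transpose_apply, sum_mul_sum]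
      refine sum_le_sum fun k _ => sum_le_sum fun l _ => ?_
      exact mul_le_of_le_one_right (mul_nonneg (hP i k) (hP i l)) (hG1 k l)
    nlinarith
  have hφ1 : φ ≤ 1 := hGv ▸ hG v v
  have hterm : ∀ k l, 0 ≤ P i k * P j l * (G k l - φ) := fun k l =>
    mul_nonneg (mul_nonneg (hP i k) (hP j l)) (sub_nonneg.2 (hG k l))
  have hsplit : (P * G * P.transpose) i j =
      φ * ((∑ k, P i k) * ∑ l, P j l) + ∑ k, ∑ l, P i k * P j l * (G k l - φ) := by
    rw [mul_mul_transpose_apply, sum_mul_sum, mul_sum, ← sum_add_distrib]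
    refine sum_congr rfl fun k _ => ?_
    rw [mul_sum, ← sum_add_distrib]
    exact sum_congr rfl fun l _ => by ring
  have hv : P i v * P j v * (1 - φ) ≤ ∑ k, ∑ l, P i k * P j l * (G k l - φ) := by
    calc P i v * P j v * (1 - φ) = P i v * P j v * (G v v - φ) := by rw [hGv]
      _ ≤ ∑ l, P i v * P j l * (G v l - φ) :=
          single_le_sum (f := fun l => P i v * P j l * (G v l - φ)) (fun l _ => hterm v l)
            (mem_univ v)
      _ ≤ _ := single_le_sum (f := fun k => ∑ l, P i k * P j l * (G k l - φ))
            (fun k _ => sum_nonneg fun l _ => hterm k l) (mem_univ v)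
  have hδ2 : δ ^ 2 ≤ P i v * P j v := by
    rw [pow_two]
    exact mul_le_mul (hPv i) (hPv j) hδ (hP i v)
  have hone : 1 ≤ (∑ k, P i k) * ∑ l, P j l := one_le_mul_of_one_le_of_one_le (hsum i) (hsum j)
  have h1 := mul_le_mul_of_nonneg_right hδ2 (sub_nonneg.2 hφ1)
  have h2 := mul_le_mul_of_nonneg_left hone hφ
  rw [hsplit]
  linarith

/-- Transition matrices over several steps of a Gram-matrix dynamics `G ↦ M G Mᵀ`. -/
theorem exists_gram_transition {N : ℕ} {E : Fin N → Fin N → Prop}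
    {G M : ℕ → Matrix (Fin N) (Fin N) ℝ} {ε : ℝ} (hε : 0 ≤ ε)
    (hstep : ∀ t, G (t + 1) = M t * G t * (M t).transpose)
    (hM : ∀ t i j, 0 ≤ M t i j) (hME : ∀ t i j, E j i → ε ≤ M t i j) (m t : ℕ) :
    ∃ P : Matrix (Fin N) (Fin N) ℝ, G (t + m) = P * G t * P.transpose ∧ (∀ i j, 0 ≤ P i j) ∧
      ∀ i j, relPow E m j i → ε ^ m ≤ P i j := by
  induction m generalizing t with
  | zero =>
    refine ⟨1, by simp, fun i j => ?_, fun i j h => ?_⟩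
    · rw [Matrix.one_apply]; split_ifs <;> norm_num
    · cases h; simp
  | succ m ih =>
    obtain ⟨P, hPG, hP, hPE⟩ := ih (t + 1)
    refine ⟨P * M t, ?_, fun i j => ?_, fun i j h => ?_⟩
    · rw [show t + (m + 1) = t + 1 + m by ring, hPG, hstep t]
      simp only [Matrix.transpose_mul, Matrix.mul_assoc]
    · rw [Matrix.mul_apply]
      exact sum_nonneg fun k _ => mul_nonneg (hP i k) (hM t k j)
    · obtain ⟨c, hc, hcm⟩ := h
      rw [pow_succ, Matrix.mul_apply]
      calc ε ^ m * ε ≤ P i c * M t c j :=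
            mul_le_mul (hPE i c hcm) (hME t c j hc) hε (hP i c)
        _ ≤ _ := single_le_sum (f := fun k => P i k * M t k j)
            (fun k _ => mul_nonneg (hP i k) (hM t k j)) (mem_univ c)

/-- Geometric convergence of the entries of the Gram matrix to one. -/
theorem gram_apply_ge {N : ℕ} {E : Fin N → Fin N → Prop}
    {G M : ℕ → Matrix (Fin N) (Fin N) ℝ} {ε : ℝ} (hε : 0 ≤ ε) (hε1 : ε ≤ 1) {r : ℕ} {v : Fin N}
    (hv : ∀ u, relPow E r v u)
    (hstep : ∀ t, G (t + 1) = M t * G t * (M t).transpose)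
    (hM : ∀ t i j, 0 ≤ M t i j) (hME : ∀ t i j, E j i → ε ≤ M t i j)
    (hdiag : ∀ t i, G t i i = 1) (hle : ∀ t i j, G t i j ≤ 1) (h0 : ∀ i j, 0 ≤ G 0 i j)
    (n s : ℕ) (i j : Fin N) :
    1 - (1 - ε ^ (2 * r)) ^ n ≤ G (r * n + s) i j := by
  have hq0 : 0 ≤ 1 - ε ^ (2 * r) := sub_nonneg.2 (pow_le_one₀ hε hε1)
  have hq1 : 1 - ε ^ (2 * r) ≤ 1 := sub_le_self _ (pow_nonneg hε _)
  have hφ : ∀ n : ℕ, 0 ≤ 1 - (1 - ε ^ (2 * r)) ^ n := fun n =>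
    sub_nonneg.2 (pow_le_one₀ hq0 hq1)
  induction s generalizing i j with
  | zero =>
    induction n generalizing i j with
    | zero => simpa using h0 i j
    | succ n ih =>
      obtain ⟨P, hPG, hP, hPE⟩ := exists_gram_transition hε hstep hM hME r (r * n)
      have h := le_congruence_apply hP (pow_nonneg hε r) (fun i => hPE i v (hv i)) (hφ n)
        ih (hle (r * n)) (hdiag (r * n) v) (fun i => hPG ▸ hdiag _ i) i j
      rw [add_zero, ← hPG] at h
      rw [show r * (n + 1) + 0 = r * n + r by ring]
      refine le_trans (le_of_eq ?_) h
      ring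
  | succ s ih =>
    have h := le_congruence_apply (hM (r * n + s)) le_rfl (fun i => hM _ i v) (hφ n)
      ih (hle _) (hdiag _ v) (fun i => hstep (r * n + s) ▸ hdiag _ i) i j
    rw [← hstep] at h
    simpa [add_assoc] using h

theorem muMeasure_le_sqrt {N d : ℕ} (hN : 0 < N) {X : Matrix (Fin N) (Fin d) ℝ} {φ : ℝ}
    (hunit : ∀ i, ∑ k, X i k ^ 2 = 1) (hφ : ∀ i j, φ ≤ ∑ k, X i k * X j k) :
    muMeasure X ≤ Real.sqrt (N * (1 - φ)) := by
  have hN' : (0 : ℝ) < N := by exact_mod_cast hN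
  refine Real.sqrt_le_sqrt ?_
  simp only [Matrix.sub_apply, Matrix.of_apply]
  have hcol : ∀ k, ∑ i, (X i k - (∑ a, X a k) / N) ^ 2 =
      ∑ i, X i k ^ 2 - (∑ a, X a k) ^ 2 / N := by
    intro k
    simp only [sub_sq, sum_add_distrib, sum_sub_distrib, ← sum_mul, ← mul_sum, sum_const, card_univ,
      Fintype.card_fin, nsmul_eq_mul]
    field_simp
    ring
  have hcross : ∑ k, (∑ a, X a k) ^ 2 = ∑ i, ∑ j, ∑ k, X i k * X j k := by
    simp only [pow_two, sum_mul_sum]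
    rw [sum_comm]
    exact sum_congr rfl fun i _ => sum_comm
  have hge : N * (N * φ) ≤ ∑ i, ∑ j, ∑ k, X i k * X j k := by
    calc (N : ℝ) * (N * φ) = ∑ _i : Fin N, ∑ _j : Fin N, φ := by simp
      _ ≤ _ := sum_le_sum fun i _ => sum_le_sum fun j _ => hφ i j
  rw [sum_comm]
  simp only [hcol, sum_sub_distrib]
  rw [sum_comm, ← sum_div, hcross]
  simp only [hunit, sum_const, card_univ, Fintype.card_fin, nsmul_eq_mul, mul_one]
  have : N * φ ≤ (∑ i, ∑ j, ∑ k, X i k * X j k) / N := by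
    rw [le_div_iff₀ hN']; linarith
  linarith

theorem sqrt_mul_pow_div_le {a q : ℝ} (hq : 0 < q) (hq1 : q ≤ 1) (ha : 0 ≤ a)
    {r : ℕ} (hr : 0 < r) (t : ℕ) :
    Real.sqrt (a * q ^ (t / r)) ≤ Real.sqrt (a / q) * q ^ ((t : ℝ) / (2 * r)) := by
  have hr' : (0 : ℝ) < r := by exact_mod_cast hr
  have hfloor : (t : ℝ) / r - 1 ≤ ((t / r : ℕ) : ℝ) := by
    rw [sub_le_iff_le_add, div_le_iff₀ hr']
    have h := (Nat.lt_div_mul_add hr (a := t)).le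
    have : (t : ℝ) ≤ ((t / r : ℕ) : ℝ) * r + r := by exact_mod_cast h
    linarith
  have hpow : q ^ (t / r) ≤ q ^ ((t : ℝ) / r) / q := by
    rw [← Real.rpow_natCast, ← Real.rpow_sub_one hq.ne']
    exact Real.rpow_le_rpow_of_exponent_ge hq hq1 hfloor
  have hsq : q ^ ((t : ℝ) / (2 * r)) = Real.sqrt (q ^ ((t : ℝ) / r)) := by
    rw [Real.sqrt_eq_rpow, ← Real.rpow_mul hq.le]
    congr 1
    field_simp
  rw [hsq, ← Real.sqrt_mul (div_nonneg ha hq.le)]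
  refine Real.sqrt_le_sqrt ?_
  calc a * q ^ (t / r) ≤ a * (q ^ ((t : ℝ) / r) / q) := mul_le_mul_of_nonneg_left hpow ha
    _ = a / q * q ^ ((t : ℝ) / r) := by ring

theorem sum_mul_le_one_of_unit {n : ℕ} {x y : Fin n → ℝ} (hx : ∑ k, x k ^ 2 = 1)
    (hy : ∑ k, y k ^ 2 = 1) : ∑ k, x k * y k ≤ 1 := by
  have h : ∑ k, 2 * (x k * y k) ≤ ∑ k, (x k ^ 2 + y k ^ 2) :=
    sum_le_sum fun k _ => by nlinarith [sq_nonneg (x k - y k)]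
  rw [← mul_sum, sum_add_distrib, hx, hy] at h
  linarith

/-- The squared norm of an output row before normalization, when the value matrix is orthogonal
and the input rows are unit vectors at pairwise nonobtuse angles. -/
theorem attention_row_sq_norm {N d : ℕ} {A : Matrix (Fin N) (Fin N) ℝ}
    {X : Matrix (Fin N) (Fin d) ℝ} {W : Matrix (Fin d) (Fin d) ℝ} (hW : W * W.transpose = 1)
    (hA : ∀ i j, 0 ≤ A i j) (hA1 : ∀ i, ∑ j, A i j = 1)
    (hunit : ∀ i, ∑ k, X i k ^ 2 = 1) (hpos : ∀ i j, 0 ≤ ∑ k, X i k * X j k) (i : Fin N) :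
    A i i ^ 2 ≤ ∑ k, (A * X * W) i k ^ 2 ∧ ∑ k, (A * X * W) i k ^ 2 ≤ 1 := by
  have hG : ∀ k l, (X * X.transpose) k l = ∑ a, X k a * X l a := fun _ _ => rfl
  have hrow : ∑ k, (A * X * W) i k ^ 2 = (A * (X * X.transpose) * A.transpose) i i := by
    have : A * (X * X.transpose) * A.transpose = A * X * W * (A * X * W).transpose := by
      simp only [Matrix.transpose_mul, Matrix.mul_assoc]
      rw [← Matrix.mul_assoc W, hW, Matrix.one_mul]
    rw [this, Matrix.mul_apply]
    exact sum_congr rfl fun k _ => by rw [Matrix.transpose_apply, pow_two]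
  rw [hrow, mul_mul_transpose_apply]
  have hterm : ∀ k l, 0 ≤ A i k * A i l * (X * X.transpose) k l := fun k l =>
    mul_nonneg (mul_nonneg (hA i k) (hA i l)) (hpos k l)
  constructor
  · have hii : (X * X.transpose) i i = 1 := by
      rw [hG, ← hunit i]
      exact sum_congr rfl fun k _ => (pow_two _).symm
    calc A i i ^ 2 = A i i * A i i * (X * X.transpose) i i := by rw [hii]; ring
      _ ≤ ∑ l, A i i * A i l * (X * X.transpose) i l :=
          single_le_sum (f := fun l => A i i * A i l * (X * X.transpose) i l)
            (fun l _ => hterm i l) (mem_univ i)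
      _ ≤ _ := single_le_sum (f := fun k => ∑ l, A i k * A i l * (X * X.transpose) k l)
            (fun k _ => sum_nonneg fun l _ => hterm k l) (mem_univ i)
  · calc ∑ k, ∑ l, A i k * A i l * (X * X.transpose) k l ≤ ∑ k, ∑ l, A i k * A i l :=
          sum_le_sum fun k _ => sum_le_sum fun l _ =>
            mul_le_of_le_one_right (mul_nonneg (hA i k) (hA i l))
              (sum_mul_le_one_of_unit (hunit k) (hunit l))
      _ = 1 := by rw [← sum_mul_sum, hA1, one_mul]


/-- **Corollary 1.** LayerNorm self-attention dynamics over a quasi-strongly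
connected graph with self-loops and radius `r`, with orthogonal value matrices, bounded
query/key matrices, unit-norm initial rows, and nonnegative initial minimal cosine similarity
`φ^{(0)} ≥ 0`: the dynamics is well-defined and there are `C > 0` and `ε > 0` with `Nε < 1`
such that `μ(X^{(t)}) ≤ C (1 - ε^{2r})^{t/(2r)}`, i.e. tokens converge exponentially to a
common point on the unit sphere. -/
theorem layernorm_attention_rank_collapse_quasi
    (N d : ℕ) (hN : 0 < N) (hd : 0 < d)
    (E : Fin N → Fin N → Prop) [DecidableRel E]
    (hloop : ∀ i, E i i)
    (hqsc : ∃ v, ∀ u, ∃ m, relPow E m v u)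
    (r : ℕ)
    (hradius : IsLeast {ρ : ℕ | ∃ v, ∀ u, ∃ m ≤ ρ, relPow E m v u} r)
    (WQ WK WV : ℕ → Matrix (Fin d) (Fin d) ℝ)
    (C₀ : ℝ)
    (hQK : ∀ t, specNorm (WQ t) ≤ C₀ ∧ specNorm (WK t) ≤ C₀)
    (hWV : ∀ t, WV t * (WV t).transpose = 1)
    (X : ℕ → Matrix (Fin N) (Fin d) ℝ)
    (hunit : ∀ i, ∑ k, (X 0 i k) ^ 2 = 1)
    (hphi0 : 0 ≤ ⨅ p : Fin N × Fin N, ∑ k, X 0 p.1 k * X 0 p.2 k)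
    (A : ℕ → Matrix (Fin N) (Fin N) ℝ)
    (hA : ∀ t, A t = maskedAttn E ((Real.sqrt d)⁻¹ • (X t * WQ t * (X t * WK t).transpose)))
    (hX : ∀ t i j,
      X (t + 1) i j =
        (A t * X t * WV t) i j / Real.sqrt (∑ k, ((A t * X t * WV t) i k) ^ 2)) :
    (∀ t i, (fun k => (A t * X t * WV t) i k) ≠ 0) ∧
    ∃ C > 0, ∃ ε > 0, (N : ℝ) * ε < 1 ∧
      ∀ t : ℕ,
        muMeasure (X t) ≤
          C * (1 - ε ^ (2 * r)) ^ ((t : ℝ) / (2 * (r : ℝ))) := by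
  have hA0 : ∀ t i j, 0 ≤ A t i j := fun t i j => hA t ▸ maskedAttn_nonneg _ i j
  have hA1 : ∀ t i, ∑ j, A t i j = 1 := fun t i => hA t ▸ sum_maskedAttn _ hloop i
  have hAii : ∀ t i, 0 < A t i i := by
    intro t i
    rw [hA t]
    simp only [maskedAttn, Matrix.of_apply, if_pos (hloop i)]
    exact div_pos (Real.exp_pos _) (sum_pos (fun _ _ => Real.exp_pos _) ⟨i, by simp [hloop]⟩)
  set s : ℕ → Fin N → ℝ := fun t i => ∑ k, ((A t * X t * WV t) i k) ^ 2 with hs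
  set M : ℕ → Matrix (Fin N) (Fin N) ℝ := fun t =>
    Matrix.diagonal (fun i => (Real.sqrt (s t i))⁻¹) * A t with hMdef
  have hM_apply : ∀ t i j, M t i j = (Real.sqrt (s t i))⁻¹ * A t i j := fun t i j => by
    simp only [hMdef, Matrix.diagonal_mul]
  have hM0 : ∀ t i j, 0 ≤ M t i j := fun t i j => by
    rw [hM_apply]
    exact mul_nonneg (inv_nonneg.2 (Real.sqrt_nonneg _)) (hA0 t i j)
  set G : ℕ → Matrix (Fin N) (Fin N) ℝ := fun t => X t * (X t).transpose with hGdef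
  have hG : ∀ t i j, G t i j = ∑ k, X t i k * X t j k := fun _ _ _ => rfl
  have hstep : ∀ t, G (t + 1) = M t * G t * (M t).transpose := by
    intro t
    have hXM : X (t + 1) = M t * X t * WV t := by
      ext i j
      rw [hX, hMdef]
      simp only [Matrix.mul_assoc, Matrix.diagonal_mul]
      rw [div_eq_inv_mul, hs]
      simp only [Matrix.mul_assoc]
    simp only [hGdef, hXM, Matrix.transpose_mul, Matrix.mul_assoc]
    rw [← Matrix.mul_assoc (WV t), hWV, Matrix.one_mul]
  have hinv : ∀ t, (∀ i, ∑ k, (X t i k) ^ 2 = 1) ∧ ∀ i j, 0 ≤ ∑ k, X t i k * X t j k := by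
    intro t
    induction t with
    | zero =>
      exact ⟨hunit, fun i j => hphi0.trans (ciInf_le (Set.finite_range _).bddBelow (i, j))⟩
    | succ t ih =>
      refine ⟨fun i => ?_, fun i j => ?_⟩
      · have hpos : 0 < s t i := lt_of_lt_of_le (pow_pos (hAii t i) 2)
          (attention_row_sq_norm (hWV t) (hA0 t) (hA1 t) ih.1 ih.2 i).1
        simp only [hX, div_pow]
        rw [← sum_div, Real.sq_sqrt hpos.le]
        exact div_self hpos.ne'
      · rw [← hG, hstep, mul_mul_transpose_apply]
        exact sum_nonneg fun k _ => sum_nonneg fun l _ =>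
          mul_nonneg (mul_nonneg (hM0 t i k) (hM0 t j l)) (ih.2 k l)
  have hs_bounds : ∀ t i, 0 < s t i ∧ s t i ≤ 1 := fun t i =>
    have h := attention_row_sq_norm (hWV t) (hA0 t) (hA1 t) (hinv t).1 (hinv t).2 i
    ⟨lt_of_lt_of_le (pow_pos (hAii t i) 2) h.1, h.2⟩
  refine ⟨fun t i h0 => ?_, ?_⟩
  · refine (hs_bounds t i).1.ne' (sum_eq_zero fun k _ => ?_)
    rw [show (A t * X t * WV t) i k = 0 from congrFun h0 k]
    norm_num
  set B : ℝ := (Real.sqrt d)⁻¹ * (d * ((d * C₀) * (d * C₀))) with hB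
  have hB0 : 0 ≤ B := mul_nonneg (inv_nonneg.2 (Real.sqrt_nonneg _))
    (mul_nonneg (Nat.cast_nonneg _) (mul_self_nonneg _))
  set ε : ℝ := Real.exp (-(2 * B)) / (N + 1) with hεdef
  have hN' : (1 : ℝ) ≤ N := by exact_mod_cast hN
  have hε : 0 < ε := by positivity
  have hNε : (N : ℝ) * ε < 1 := by
    have hexp : Real.exp (-(2 * B)) ≤ 1 := Real.exp_le_one_iff.2 (by linarith)
    rw [hεdef, mul_div_assoc', div_lt_one (by positivity)]
    nlinarith
  have hε1 : ε < 1 := by nlinarith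
  have hX1 : ∀ t i k, |X t i k| ≤ 1 := fun t i k => by
    rw [← sq_le_one_iff_abs_le_one, ← (hinv t).1 i]
    exact single_le_sum (f := fun k => X t i k ^ 2) (fun k _ => sq_nonneg _) (mem_univ k)
  have hAE : ∀ t i j, E j i → ε ≤ A t i j := fun t i j h => by
    rw [hA t]
    exact le_maskedAttn _ (abs_attention_score_le (hX1 t) (hQK t).1 (hQK t).2) h
  have hME : ∀ t i j, E j i → ε ≤ M t i j := fun t i j h => by
    rw [hM_apply]
    have hone : 1 ≤ (Real.sqrt (s t i))⁻¹ :=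
      (one_le_inv₀ (Real.sqrt_pos.2 (hs_bounds t i).1)).2 (Real.sqrt_le_one.2 (hs_bounds t i).2)
    exact (hAE t i j h).trans (le_mul_of_one_le_left (hA0 t i j) hone)
  have hdiag : ∀ t i, G t i i = 1 := fun t i => by
    rw [hG, ← (hinv t).1 i]
    exact sum_congr rfl fun k _ => (pow_two _).symm
  obtain ⟨v, hv⟩ := hradius.1
  have hvr : ∀ u, relPow E r v u := fun u => by
    obtain ⟨m, hm, h⟩ := hv u
    exact relPow_mono_of_refl hloop hm h
  rcases Nat.eq_zero_or_pos r with rfl | hr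
  · refine ⟨1, one_pos, ε, hε, hNε, fun t => ?_⟩
    have hGone : ∀ i j, 1 ≤ ∑ k, X t i k * X t j k := fun i j => by
      have hi : v = i := hvr i
      have hj : v = j := hvr j
      rw [← hi, ← hj]
      exact (hdiag t v).ge
    have h := muMeasure_le_sqrt hN (hinv t).1 hGone
    rw [sub_self, mul_zero, Real.sqrt_zero] at h
    exact h.trans (by simp)
  · set q : ℝ := 1 - ε ^ (2 * r) with hq
    have hq0 : 0 < q := sub_pos.2 (pow_lt_one₀ hε.le hε1 (by omega))
    have hq1 : q ≤ 1 := sub_le_self _ (pow_nonneg hε.le _)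
    refine ⟨Real.sqrt (N / q), Real.sqrt_pos.2 (by positivity), ε, hε, hNε, fun t => ?_⟩
    have hφ : ∀ i j, 1 - q ^ (t / r) ≤ ∑ k, X t i k * X t j k := fun i j => by
      have h := gram_apply_ge hε.le hε1.le hvr hstep hM0 hME hdiag
        (fun t i j => sum_mul_le_one_of_unit ((hinv t).1 i) ((hinv t).1 j)) (hinv 0).2
        (t / r) (t % r) i j
      rwa [Nat.div_add_mod] at h
    have h := muMeasure_le_sqrt hN (hinv t).1 hφ
    rw [sub_sub_cancel] at h
    exact h.trans (sqrt_mul_pow_div_le hq0 hq1 (by positivity) hr t)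
end

section
/- Let w > 1 and W = [[1, w], [0, 1]] (acting on row vectors by xW = (x₁, w x₁ + x₂)). Define the map F on the unit circle by F(x) = y/‖y‖₂ where y = ((0,1) + x) W / 2, wherever y ≠ 0. Then: (i) the two points A = (−1/w, √(1 − 1/w²)) and B = (−1/w, −√(1 − 1/w²)) are fixed points of F; and (ii) the closed arc {x ∈ 𝕊¹ : x₁ ≤ −1/w} is invariant under F, i.e., F is well-defined on this arc and maps it into itself. -/
/-- The update map of the second token in the `N = d = 2` causal LayerNorm self-attention
dynamics, assuming the first token is fixed at `(0, 1)`: `F(x) = y / ‖y‖₂` where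
`y = ((0,1) + x) W / 2` and `W = [[1, w], [0, 1]]` acts on row vectors. -/
noncomputable def secondTokenMap (w : ℝ) (x : ℝ × ℝ) : ℝ × ℝ :=
  let y : ℝ × ℝ := (x.1 / 2, (w * x.1 + x.2 + 1) / 2)
  (y.1 / Real.sqrt (y.1 ^ 2 + y.2 ^ 2), y.2 / Real.sqrt (y.1 ^ 2 + y.2 ^ 2))

/-- Every point of the unit circle with first coordinate `-1/w` is fixed. -/
theorem secondTokenMap_eq_self {w : ℝ} (hw : w ≠ 0) {b : ℝ} (hb : (-(1 / w)) ^ 2 + b ^ 2 = 1) :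
    secondTokenMap w (-(1 / w), b) = (-(1 / w), b) := by
  have hc : w * -(1 / w) + b + 1 = b := by
    field_simp
    ring
  have hs : √((-(1 / w) / 2) ^ 2 + (b / 2) ^ 2) = 1 / 2 := by
    rw [show (-(1 / w) / 2) ^ 2 + (b / 2) ^ 2 = (1 / 2 : ℝ) ^ 2 by linear_combination hb / 4]
    exact Real.sqrt_sq (by norm_num)
  simp only [secondTokenMap, hc, hs, Prod.mk.injEq]
  constructor <;> ring

/-- On the arc `{x ∈ 𝕊¹ : x₁ ≤ -1/w}` the unnormalized update stays in the cone
`‖y‖₂ ≤ -w y₁`. -/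
theorem sq_add_sq_update_le {w a b : ℝ} (h : a ^ 2 + b ^ 2 = 1) (ha : w * a ≤ -1) :
    (a / 2) ^ 2 + ((w * a + b + 1) / 2) ^ 2 ≤ (-(w * (a / 2))) ^ 2 := by
  have hb : -1 ≤ b := by nlinarith [sq_nonneg a]
  nlinarith [mul_nonneg (sub_nonneg.2 ha) (sub_nonneg.2 hb)]

/-- For `w > 1`: (i) the points `A = (-1/w, √(1 - 1/w²))` and
`B = (-1/w, -√(1 - 1/w²))` are fixed points of `F`; (ii) the closed arc
`{x ∈ 𝕊¹ : x₁ ≤ -1/w}` is invariant under `F` (and `F` is well-defined there). -/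
theorem second_token_fixed_points_and_invariance (w : ℝ) (hw : 1 < w) :
    (secondTokenMap w (-(1 / w), Real.sqrt (1 - 1 / w ^ 2)) =
      (-(1 / w), Real.sqrt (1 - 1 / w ^ 2))) ∧
    (secondTokenMap w (-(1 / w), -Real.sqrt (1 - 1 / w ^ 2)) =
      (-(1 / w), -Real.sqrt (1 - 1 / w ^ 2))) ∧
    (∀ x : ℝ × ℝ, x.1 ^ 2 + x.2 ^ 2 = 1 → x.1 ≤ -(1 / w) →
      ((x.1 / 2, (w * x.1 + x.2 + 1) / 2) ≠ ((0 : ℝ), (0 : ℝ)) ∧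
        (secondTokenMap w x).1 ^ 2 + (secondTokenMap w x).2 ^ 2 = 1 ∧
        (secondTokenMap w x).1 ≤ -(1 / w))) := by
  have hw0 : 0 < w := by linarith
  have hle : 1 / w ^ 2 ≤ 1 := by
    rw [div_le_one (by positivity)]
    nlinarith
  have hs : √(1 - 1 / w ^ 2) ^ 2 = 1 - 1 / w ^ 2 := Real.sq_sqrt (by linarith)
  refine ⟨secondTokenMap_eq_self hw0.ne' ?_, secondTokenMap_eq_self hw0.ne' ?_, ?_⟩
  · rw [hs]
    ring
  · rw [neg_sq √_, hs]
    ring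
  rintro ⟨a, b⟩ h ha
  dsimp only at h ha ⊢
  have hwa : w * a ≤ -1 := by
    have := mul_le_mul_of_nonneg_left ha hw0.le
    rwa [mul_neg, mul_one_div_cancel hw0.ne'] at this
  have ha0 : a ≠ 0 := by
    rintro rfl
    linarith
  have hpos : 0 < (a / 2) ^ 2 + ((w * a + b + 1) / 2) ^ 2 := by positivity
  refine ⟨fun h0 => ha0 (by simpa using congrArg Prod.fst h0), ?_, ?_⟩
  · simp only [secondTokenMap]
    rw [div_pow _ √_, div_pow _ √_, Real.sq_sqrt hpos.le, ← add_div, div_self hpos.ne']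
  · simp only [secondTokenMap]
    have hsqrt := Real.sqrt_le_sqrt (sq_add_sq_update_le h hwa)
    rw [Real.sqrt_sq (by linarith)] at hsqrt
    rw [div_le_iff₀ (Real.sqrt_pos.2 hpos), neg_mul, one_div_mul_eq_div, le_neg,
      div_le_iff₀ hw0]
    linarith
end

section
/- Let N = d = 2, w > 1, W_V = [[1, w], [0, 1]], and consider the causal self-attention dynamics with LayerNorm and W_Q = W_K = 0: X₁^{(t+1)} = X₁^{(t)} W_V / ‖X₁^{(t)} W_V‖₂ and X₂^{(t+1)} = ((X₁^{(t)} + X₂^{(t)}) W_V / 2) / ‖(X₁^{(t)} + X₂^{(t)}) W_V / 2‖₂, with rows on the unit circle. If X₁^{(0)} = (0, 1) and X_{2,1}^{(0)} ≤ −1/w, then for all t ≥ 0: X₁^{(t)} = (0, 1), X_{2,1}^{(t)} ≤ −1/w, and μ(X^{(t)}) = ‖X₁^{(t)} − X₂^{(t)}‖₂/√2 ≥ 1/(w√2) > 0. In particular, X^{(t)} does not converge to a rank-one configuration (the two tokens never collapse to a common point). -/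
/-- Normalizing a vector with nonzero first coordinate puts it on the unit circle. -/
lemma div_sqrt_sq_add_sq_eq_one {p : ℝ} (hp : p ≠ 0) (q : ℝ) :
    (p / Real.sqrt (p ^ 2 + q ^ 2)) ^ 2 + (q / Real.sqrt (p ^ 2 + q ^ 2)) ^ 2 = 1 := by
  have h : 0 < p ^ 2 + q ^ 2 := by positivity
  rw [div_pow, div_pow, Real.sq_sqrt h.le, ← add_div, div_self h.ne']

/-- If a unit vector `(a, b)` satisfies `a ≤ -1/w`, then so does the normalized image of the
midpoint of `(0, 1)` and `(a, b)` under `(x, y) ↦ (x, w x + y)`. -/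
lemma midpoint_image_div_sqrt_le {w a b : ℝ} (hw : 0 < w) (hab : a ^ 2 + b ^ 2 = 1)
    (ha : a ≤ -(1 / w)) :
    a / 2 / Real.sqrt ((a / 2) ^ 2 + ((w * a + (1 + b)) / 2) ^ 2) ≤ -(1 / w) := by
  have hwinv : 0 < 1 / w := by positivity
  have ha0 : a < 0 := by linarith
  have hwa : w * a ≤ -1 := by
    calc w * a ≤ w * -(1 / w) := by gcongr
      _ = -1 := by field_simp
  have hb : 0 ≤ 1 + b := by nlinarith
  have hpos : 0 < (a / 2) ^ 2 + ((w * a + (1 + b)) / 2) ^ 2 := by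
    have := ha0.ne
    positivity
  have hle : Real.sqrt ((a / 2) ^ 2 + ((w * a + (1 + b)) / 2) ^ 2) ≤ -(w * a) / 2 := by
    apply Real.sqrt_le_iff.mpr ⟨by linarith, ?_⟩
    nlinarith [mul_nonneg hb (show 0 ≤ -1 - w * a by linarith)]
  rw [div_le_iff₀ (Real.sqrt_pos.mpr hpos)]
  calc a / 2 = -(1 / w) * (-(w * a) / 2) := by field_simp
    _ ≤ _ := mul_le_mul_of_nonpos_left hle (by linarith)


/-- The `N = d = 2` causal self-attention dynamics with LayerNorm,
`W_Q = W_K = 0`, and value matrix `W_V = [[1, w], [0, 1]]` (`w > 1`): if `X₁^{(0)} = (0, 1)`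
and `X_{2,1}^{(0)} ≤ -1/w`, then for every `t`, `X₁^{(t)} = (0, 1)`,
`X_{2,1}^{(t)} ≤ -1/w`, and `μ(X^{(t)}) = ‖X₁^{(t)} - X₂^{(t)}‖₂/√2 ≥ 1/(w√2) > 0`;
in particular the two tokens never collapse to a common point. -/
theorem layernorm_counterexample_no_collapse
    (w : ℝ) (hw : 1 < w)
    (X1 X2 : ℕ → ℝ × ℝ)
    (hX1_0 : X1 0 = ((0 : ℝ), (1 : ℝ)))
    (hX2_0 : (X2 0).1 ^ 2 + (X2 0).2 ^ 2 = 1)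
    (hX2_0' : (X2 0).1 ≤ -(1 / w))
    (hstep1 : ∀ t, X1 (t + 1) =
      ((X1 t).1 / Real.sqrt ((X1 t).1 ^ 2 + (w * (X1 t).1 + (X1 t).2) ^ 2),
       (w * (X1 t).1 + (X1 t).2) /
         Real.sqrt ((X1 t).1 ^ 2 + (w * (X1 t).1 + (X1 t).2) ^ 2)))
    (hstep2 : ∀ t, X2 (t + 1) =
      ((((X1 t).1 + (X2 t).1) / 2) /
          Real.sqrt ((((X1 t).1 + (X2 t).1) / 2) ^ 2 +
            ((w * ((X1 t).1 + (X2 t).1) + ((X1 t).2 + (X2 t).2)) / 2) ^ 2),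
       ((w * ((X1 t).1 + (X2 t).1) + ((X1 t).2 + (X2 t).2)) / 2) /
          Real.sqrt ((((X1 t).1 + (X2 t).1) / 2) ^ 2 +
            ((w * ((X1 t).1 + (X2 t).1) + ((X1 t).2 + (X2 t).2)) / 2) ^ 2))) :
    ∀ t : ℕ,
      X1 t = ((0 : ℝ), (1 : ℝ)) ∧
      (X2 t).1 ≤ -(1 / w) ∧
      1 / (w * Real.sqrt 2) ≤
        Real.sqrt (((X1 t).1 - (X2 t).1) ^ 2 + ((X1 t).2 - (X2 t).2) ^ 2) /
          Real.sqrt 2 ∧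
      0 <
        Real.sqrt (((X1 t).1 - (X2 t).1) ^ 2 + ((X1 t).2 - (X2 t).2) ^ 2) /
          Real.sqrt 2 := by
  have hw0 : 0 < w := by linarith
  have key : ∀ t, X1 t = ((0 : ℝ), (1 : ℝ)) ∧ (X2 t).1 ^ 2 + (X2 t).2 ^ 2 = 1 ∧
      (X2 t).1 ≤ -(1 / w) := by
    intro t
    induction t with
    | zero => exact ⟨hX1_0, hX2_0, hX2_0'⟩
    | succ t ih =>
      obtain ⟨h1, hunit, hle⟩ := ih
      have hne : (X2 t).1 / 2 ≠ 0 := by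
        have : 0 < 1 / w := by positivity
        linarith
      refine ⟨by simp [hstep1, h1], ?_, ?_⟩
      · simpa only [hstep2, h1, zero_add] using div_sqrt_sq_add_sq_eq_one hne _
      · simpa only [hstep2, h1, zero_add] using midpoint_image_div_sqrt_le hw0 hunit hle
  intro t
  obtain ⟨h1, -, hle⟩ := key t
  have hbound : 1 / (w * Real.sqrt 2) ≤
      Real.sqrt (((X1 t).1 - (X2 t).1) ^ 2 + ((X1 t).2 - (X2 t).2) ^ 2) / Real.sqrt 2 := by
    rw [← div_div]
    gcongr
    apply Real.le_sqrt_of_sq_le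
    have hfst : (1 / w) ^ 2 ≤ ((X1 t).1 - (X2 t).1) ^ 2 := by
      gcongr
      rw [h1]
      linarith
    exact hfst.trans (le_add_of_nonneg_right (sq_nonneg _))
  exact ⟨h1, hle, hbound, lt_of_lt_of_le (by positivity) hbound⟩
end

section
/- Let N = d ≥ 2 and w > 1. Let A ∈ ℝ^{N×N} be the causal averaging matrix with A_{ij} = 1/i for j ≤ i and A_{ij} = 0 for j > i, and let W ∈ ℝ^{N×N} be the matrix with 1's on the diagonal, w on the superdiagonal (W_{i,i+1} = w), and 0 elsewhere (so for row vectors (xW)_j = x_j + w x_{j−1}). Define X* ∈ ℝ^{N×N} by: for each row k ∈ {1,…,N}, X*_{k,j} = 0 for j ≤ N − k; X*_{k,N−k+1} = (−1)^{k−1} w^{−(k−1)}; and X*_{k,N−m} = (−1)^{k−1} √(w^{−2m} − w^{−2(m+1)}) for 0 ≤ m ≤ k − 2. Then every row of X* has unit Euclidean norm, X* has rank N, and X* is an equilibrium of the causal LayerNorm self-attention dynamics with W_Q = W_K = 0 and value matrix W: for every i ∈ {1,…,N}, Σ_{j=1}^{i} X*_{j,:} W is nonzero and X*_{i,:} = (Σ_{j=1}^{i}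 X*_{j,:} W) / ‖Σ_{j=1}^{i} X*_{j,:} W‖₂. -/
/-- The value matrix with `1`'s on the diagonal, `w` on the superdiagonal and `0` elsewhere,
so that for row vectors `(x W)_j = x_j + w x_{j-1}`. -/
def valueMat (N : ℕ) (w : ℝ) : Matrix (Fin N) (Fin N) ℝ :=
  Matrix.of fun i j => if i = j then 1 else if (j : ℕ) = (i : ℕ) + 1 then w else 0

/-- The explicit full-rank equilibrium `X*` of the causal LayerNorm self-attention dynamics
(rows and columns indexed from `0`; the `1`-based row `k` of the paper is row `k - 1` here):
row `k` has zeros in columns `j` with `j + k + 1 < N`, the value `(-1)^k w^{-k}` in column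
`N - 1 - k`, and `(-1)^k √(w^{-2m} - w^{-2(m+1)})` in column `N - 1 - m` for `0 ≤ m ≤ k - 1`. -/
noncomputable def Xstar (N : ℕ) (w : ℝ) : Matrix (Fin N) (Fin N) ℝ :=
  Matrix.of fun k j =>
    if (j : ℕ) + (k : ℕ) + 1 < N then 0
    else if (j : ℕ) + (k : ℕ) + 1 = N then (-1 : ℝ) ^ (k : ℕ) * (w⁻¹) ^ (k : ℕ)
    else (-1 : ℝ) ^ (k : ℕ) *
      Real.sqrt ((w⁻¹) ^ (2 * (N - 1 - (j : ℕ))) - (w⁻¹) ^ (2 * (N - (j : ℕ))))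

open Finset in
/-- The partial sums of the squared entries of row `k` of `Xstar`, read from the last column. -/
lemma sum_range_sq_entries (q : ℝ) (k n : ℕ) :
    ∑ m ∈ range n, (if k < m then 0 else if m = k then q ^ (2 * k)
      else q ^ (2 * m) - q ^ (2 * (m + 1))) = if n ≤ k then 1 - q ^ (2 * n) else 1 := by
  induction n with
  | zero => simp
  | succ n ih =>
    rw [sum_range_succ, ih]
    rcases lt_trichotomy n k with h | rfl | h
    · rw [if_pos h.le, if_neg (by lia), if_neg h.ne, if_pos (by lia)]
      ring
    · simp
    · rw [if_neg (by lia), if_pos h, if_neg (by lia), add_zero]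

/-- The entry of `Xstar` in row `k`, in the `m`-th column counted from the last one. -/
lemma Xstar_rev {N : ℕ} (w : ℝ) (k m : Fin N) :
    Xstar N w k m.rev = if (k : ℕ) < m then 0
      else if (m : ℕ) = k then (-1) ^ (k : ℕ) * w⁻¹ ^ (k : ℕ)
      else (-1) ^ (k : ℕ) * √(w⁻¹ ^ (2 * (m : ℕ)) - w⁻¹ ^ (2 * ((m : ℕ) + 1))) := by
  have hk := k.isLt
  have hm := m.isLt
  simp only [Xstar, Matrix.of_apply, Fin.val_rev]
  rw [show N - 1 - (N - (m + 1)) = (m : ℕ) by lia, show N - (N - (m + 1)) = (m : ℕ) + 1 by lia]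
  congr 1
  · exact propext (by lia)
  · congr 1
    exact propext (by lia)

lemma pow_two_mul_sub_nonneg {w : ℝ} (hw : 1 < w) (m : ℕ) :
    0 ≤ w⁻¹ ^ (2 * m) - w⁻¹ ^ (2 * (m + 1)) :=
  sub_nonneg.2 <| pow_le_pow_of_le_one (by positivity) (inv_le_one_of_one_le₀ hw.le) (by lia)

lemma Xstar_row_sum_sq {N : ℕ} {w : ℝ} (hw : 1 < w) (k : Fin N) :
    ∑ j, Xstar N w k j ^ 2 = 1 := by
  have h := sum_range_sq_entries w⁻¹ k N
  rw [if_neg k.isLt.not_ge, ← Fin.sum_univ_eq_sum_range] at h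
  rw [← h, ← Equiv.sum_comp Fin.revPerm]
  refine Finset.sum_congr rfl fun m _ => ?_
  rw [Fin.revPerm_apply, Xstar_rev]
  split_ifs
  · simp
  · rw [mul_pow, ← pow_mul, ← pow_mul, mul_comm (k : ℕ) 2, pow_mul (-1 : ℝ)]
    simp
  · rw [mul_pow, Real.sq_sqrt (pow_two_mul_sub_nonneg hw _), ← pow_mul, mul_comm (k : ℕ) 2,
      pow_mul (-1 : ℝ)]
    simp

lemma Xstar_rank {N : ℕ} {w : ℝ} (hw : 1 < w) : (Xstar N w).rank = N := by
  have hdet : ((Xstar N w).submatrix id Fin.revPerm).det ≠ 0 := by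
    rw [Matrix.det_of_isLowerTriangular]
    · refine Finset.prod_ne_zero_iff.2 fun k _ => ?_
      simp only [Matrix.submatrix_apply, id, Fin.revPerm_apply, Xstar_rev]
      have : w ≠ 0 := by positivity
      simp [this]
    · intro k m hkm
      have hkm : k < m := hkm
      simp only [Matrix.submatrix_apply, id, Fin.revPerm_apply, Xstar_rev]
      exact if_pos hkm
  have h := Matrix.rank_submatrix (Xstar N w) (Equiv.refl _) Fin.revPerm
  rw [← h]
  exact (Matrix.rank_of_isUnit _ ((Matrix.isUnit_iff_isUnit_det _).2 hdet.isUnit)).trans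
    (Fintype.card_fin N)

lemma vecMul_valueMat_zero {n : ℕ} (w : ℝ) (x : Fin (n + 1) → ℝ) :
    Matrix.vecMul x (valueMat (n + 1) w) 0 = x 0 := by
  simp [Matrix.vecMul, dotProduct, valueMat]

lemma vecMul_valueMat_succ {n : ℕ} (w : ℝ) (x : Fin (n + 1) → ℝ) (c : Fin n) :
    Matrix.vecMul x (valueMat (n + 1) w) c.succ = x c.succ + w * x c.castSucc := by
  have h (i : Fin (n + 1)) : x i * valueMat (n + 1) w i c.succ =
      (if i = c.succ then x i else 0) + if i = c.castSucc then w * x i else 0 := by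
    simp only [valueMat, Matrix.of_apply, Fin.ext_iff, Fin.val_succ, Fin.val_castSucc]
    split_ifs <;> first | lia | ring
  simp [Matrix.vecMul, dotProduct, h, Finset.sum_add_distrib]

lemma mul_sqrt_pow_sub {w : ℝ} (hw : 1 < w) (m : ℕ) :
    w * √(w⁻¹ ^ (2 * (m + 1)) - w⁻¹ ^ (2 * (m + 1 + 1))) =
      √(w⁻¹ ^ (2 * m) - w⁻¹ ^ (2 * (m + 1))) := by
  have hw0 : 0 < w := by positivity
  rw [← Real.sqrt_sq hw0.le, ← Real.sqrt_mul (sq_nonneg w), Real.sqrt_sq hw0.le]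
  congr 1
  linear_combination w⁻¹ ^ (2 * m) * (1 - w⁻¹ ^ 2) * (w * w⁻¹ + 1) * mul_inv_cancel₀ hw0.ne'

lemma Xstar_zero_castSucc {n : ℕ} (w : ℝ) (c : Fin n) :
    Xstar (n + 1) w 0 c.castSucc = 0 := by
  simp [Xstar]

/-- Moving one row down and one column left multiplies the entries of `Xstar` by `-w⁻¹`. -/
lemma mul_Xstar_succ_castSucc {n : ℕ} {w : ℝ} (hw : 1 < w) (k c : Fin n) :
    w * Xstar (n + 1) w k.succ c.castSucc = -Xstar (n + 1) w k.castSucc c.succ := by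
  have hw0 : w ≠ 0 := by positivity
  obtain ⟨m, rfl⟩ : ∃ m : Fin n, c = m.rev := ⟨c.rev, (Fin.rev_rev c).symm⟩
  rw [← Fin.rev_succ, ← Fin.rev_castSucc, Xstar_rev, Xstar_rev]
  simp only [Fin.val_succ, Fin.val_castSucc, add_lt_add_iff_right, add_left_inj]
  split_ifs
  · simp
  · linear_combination -(-1) ^ (k : ℕ) * w⁻¹ ^ (k : ℕ) * mul_inv_cancel₀ hw0
  · rw [mul_left_comm, mul_sqrt_pow_sub hw]
    ring

lemma vecMul_Xstar_zero {n : ℕ} (w : ℝ) :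
    Matrix.vecMul (Xstar (n + 1) w 0) (valueMat (n + 1) w) = Xstar (n + 1) w 0 := by
  funext c
  cases c using Fin.cases with
  | zero => exact vecMul_valueMat_zero ..
  | succ c => rw [vecMul_valueMat_succ, Xstar_zero_castSucc, mul_zero, add_zero]

lemma vecMul_Xstar_succ {n : ℕ} {w : ℝ} (hw : 1 < w) (k : Fin n) :
    Matrix.vecMul (Xstar (n + 1) w k.succ) (valueMat (n + 1) w) =
      Xstar (n + 1) w k.succ - Xstar (n + 1) w k.castSucc := by
  funext c
  cases c using Fin.cases with
  | zero =>
    have h : Xstar (n + 1) w k.castSucc 0 = 0 := by simp [Xstar]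
    rw [vecMul_valueMat_zero, Pi.sub_apply, h, sub_zero]
  | succ c =>
    rw [vecMul_valueMat_succ, mul_Xstar_succ_castSucc hw, Pi.sub_apply, sub_eq_add_neg]

lemma sum_Iic_vecMul_Xstar {N : ℕ} {w : ℝ} (hw : 1 < w) (i : Fin N) :
    ∑ j ∈ Finset.Iic i, Matrix.vecMul (Xstar N w j) (valueMat N w) = Xstar N w i := by
  cases N with
  | zero => exact i.elim0
  | succ n =>
    induction i using Fin.induction with
    | zero =>
      have h : Finset.Iic (0 : Fin (n + 1)) = {0} := by ext; simp
      rw [h, Finset.sum_singleton, vecMul_Xstar_zero]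
    | succ k ih =>
      have h : Finset.Iic k.succ = insert k.succ (Finset.Iic k.castSucc) := by
        ext j
        simp only [Finset.mem_Iic, Finset.mem_insert, Fin.le_def, Fin.ext_iff, Fin.val_succ,
          Fin.val_castSucc]
        lia
      rw [h, Finset.sum_insert (by simp), ih, vecMul_Xstar_succ hw, sub_add_cancel]

/-- For `N = d ≥ 2` and `w > 1`, the matrix `X*` has unit-norm rows, has
full rank `N`, and is an equilibrium of the causal LayerNorm self-attention dynamics with
`W_Q = W_K = 0` and value matrix `W`: for every `i`, `Σ_{j ≤ i} X*_{j,:} W` is nonzero and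
`X*_{i,:}` is its normalization. -/
theorem Xstar_is_full_rank_equilibrium (N : ℕ) (hN : 2 ≤ N) (w : ℝ) (hw : 1 < w) :
    (∀ k : Fin N, ∑ j, (Xstar N w k j) ^ 2 = 1) ∧
    (Xstar N w).rank = N ∧
    (∀ i : Fin N,
      (∑ j ∈ Finset.Iic i, Matrix.vecMul (Xstar N w j) (valueMat N w)) ≠ 0 ∧
      (∀ c : Fin N,
        Xstar N w i c =
          (∑ j ∈ Finset.Iic i, Matrix.vecMul (Xstar N w j) (valueMat N w)) c /
            Real.sqrt (∑ c',
              ((∑ j ∈ Finset.Iic i, Matrix.vecMul (Xstar N w j) (valueMat N w)) c') ^ 2))) := by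
  refine ⟨Xstar_row_sum_sq hw, Xstar_rank hw, fun i => ?_⟩
  rw [sum_Iic_vecMul_Xstar hw, Xstar_row_sum_sq hw]
  refine ⟨fun h => ?_, fun c => by simp⟩
  simpa [h] using Xstar_row_sum_sq hw i
end

section
/- (Theorem 3, part 1) Let N = d and w ≥ N, and consider the causal LayerNorm self-attention dynamics with W_Q^{(t)} = W_K^{(t)} = 0 and constant value matrix W_V with 1's on the diagonal, w on the superdiagonal, and 0 elsewhere; i.e., the update map F with F(X)_{i,:} = ((1/i) Σ_{j=1}^{i} X_{j,:} W_V) / ‖(1/i) Σ_{j=1}^{i} X_{j,:} W_V‖₂. Then for every k with 1 ≤ k ≤ N, there exist at least 2^k distinct matrices X ∈ ℝ^{N×N} with all rows of unit Euclidean norm such that F(X) = X and rank(X) = k. In particular, the dynamics simultaneously possesses equilibria of every rank between 1 and full. -/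
/-- The causal LayerNorm self-attention update with `W_Q = W_K = 0` and value matrix
`valueMat N w`: token `i` (`0`-based) attends uniformly to tokens `0, …, i`, i.e. its
pre-normalization update is `(1/(i+1)) Σ_{j ≤ i} X_{j,:} W`, which is then normalized to
unit length. -/
noncomputable def causalUpdate (N : ℕ) (w : ℝ) (X : Matrix (Fin N) (Fin N) ℝ) :
    Matrix (Fin N) (Fin N) ℝ :=
  Matrix.of fun i c =>
    (((i : ℕ) + 1 : ℝ)⁻¹ * (∑ j ∈ Finset.Iic i, Matrix.vecMul (X j) (valueMat N w)) c) /
      Real.sqrt (∑ c',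
        (((i : ℕ) + 1 : ℝ)⁻¹ *
          (∑ j ∈ Finset.Iic i, Matrix.vecMul (X j) (valueMat N w)) c') ^ 2)

/-- Entries of the triangular array with first column `b` whose other entries satisfy
`z (j + 1) (l + 1) = -(q j / w) * z j l` and vanish above the diagonal. -/
noncomputable def shiftArray (w : ℝ) (q b : ℕ → ℝ) : ℕ → ℕ → ℝ
  | j, 0 => b j
  | 0, _ + 1 => 0
  | j + 1, l + 1 => -(q j / w) * shiftArray w q b j l

lemma shiftArray_zero_right (w : ℝ) (q b : ℕ → ℝ) (j : ℕ) : shiftArray w q b j 0 = b j := by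
  cases j <;> rfl

lemma shiftArray_of_lt (w : ℝ) (q b : ℕ → ℝ) {j l : ℕ} (h : j < l) :
    shiftArray w q b j l = 0 := by
  induction j generalizing l with
  | zero => obtain ⟨l, rfl⟩ := Nat.exists_eq_succ_of_ne_zero h.ne'; rfl
  | succ j ih =>
    obtain ⟨l, rfl⟩ := Nat.exists_eq_succ_of_ne_zero (Nat.ne_zero_of_lt h)
    rw [shiftArray, ih (by omega), mul_zero]

lemma shiftArray_diag_ne_zero {w : ℝ} {q b : ℕ → ℝ} (hw : w ≠ 0) (hq : ∀ j, q j ≠ 0)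
    (hb : b 0 ≠ 0) (j : ℕ) : shiftArray w q b j j ≠ 0 := by
  induction j with
  | zero => exact hb
  | succ j ih => exact mul_ne_zero (neg_ne_zero.2 (div_ne_zero (hq j) hw)) ih

lemma sum_sq_shiftArray {w : ℝ} {q b : ℕ → ℝ} {k : ℕ} (hb₀ : b 0 ^ 2 = 1)
    (hb : ∀ j, j + 1 < k → b (j + 1) ^ 2 = 1 - (q j / w) ^ 2) {j : ℕ} (hj : j < k) {n : ℕ}
    (hn : j < n) : ∑ l ∈ Finset.range n, shiftArray w q b j l ^ 2 = 1 := by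
  induction j generalizing n with
  | zero =>
    obtain ⟨n, rfl⟩ := Nat.exists_eq_succ_of_ne_zero hn.ne'
    rw [Finset.sum_range_succ', shiftArray_zero_right, hb₀]
    simp [shiftArray]
  | succ j ih =>
    obtain ⟨n, rfl⟩ := Nat.exists_eq_succ_of_ne_zero (Nat.ne_zero_of_lt hn)
    rw [Finset.sum_range_succ', shiftArray_zero_right, hb j hj]
    simp only [shiftArray, mul_pow]
    rw [← Finset.mul_sum, ih (by omega) (by omega)]
    ring

lemma vecMul_valueMat_rev {N : ℕ} (w : ℝ) (g : ℕ → ℝ) (hg : g N = 0) (c : Fin N) :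
    Matrix.vecMul (fun c : Fin N => g c.rev) (valueMat N w) c = g c.rev + w * g (c.rev + 1) := by
  have split : ∀ i : Fin N, g i.rev * valueMat N w i c =
      (if i = c then g i.rev else 0) + if (c : ℕ) = i + 1 then g i.rev * w else 0 := by
    intro i
    by_cases h : i = c
    · subst h; simp [valueMat]
    · simp [valueMat, h]
  simp only [Matrix.vecMul, dotProduct, split, Finset.sum_add_distrib]
  rw [Finset.sum_ite_eq' Finset.univ c, if_pos (Finset.mem_univ c)]
  congr 1
  obtain ⟨c, hc⟩ := c
  rcases c with _ | c
  · have : N - 1 + 1 = N := by omega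
    simp [Fin.val_rev, this, hg]
  · rw [Finset.sum_eq_single (⟨c, by omega⟩ : Fin N)]
    · have : N - (c + 1 + 1) + 1 = N - (c + 1) := by omega
      simp [Fin.val_rev, this, mul_comm]
    · intro i _ hi
      refine if_neg fun h => hi (Fin.ext ?_)
      simp only at h ⊢
      omega
    · simp

lemma causalUpdate_eq_self {N : ℕ} {w : ℝ} {X : Matrix (Fin N) (Fin N) ℝ}
    (hX : ∀ i, ∑ c, X i c ^ 2 = 1) (r : Fin N → ℝ) (hr : ∀ i, 0 < r i)
    (h : ∀ i c, (∑ j ∈ Finset.Iic i, Matrix.vecMul (X j) (valueMat N w)) c = r i * X i c) :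
    causalUpdate N w X = X := by
  ext i c
  have hpos : 0 < ((i : ℕ) + 1 : ℝ)⁻¹ * r i := mul_pos (by positivity) (hr i)
  simp only [causalUpdate, Matrix.of_apply, h, ← mul_assoc]
  simp only [mul_pow _ (X i _), ← Finset.mul_sum, hX, mul_one]
  rw [Real.sqrt_sq hpos.le, mul_div_cancel_left₀ _ hpos.ne']

/-- The matrix whose row `i` is row `i - p` of `shiftArray w q b`, written from right to left. -/
noncomputable def shiftMatrix (N p : ℕ) (w : ℝ) (q b : ℕ → ℝ) : Matrix (Fin N) (Fin N) ℝ :=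
  Matrix.of fun i c => shiftArray w q b (i - p) c.rev

lemma vecMul_shiftMatrix {N : ℕ} (p : ℕ) (w : ℝ) (q b : ℕ → ℝ) (i c : Fin N) :
    Matrix.vecMul (shiftMatrix N p w q b i) (valueMat N w) c =
      shiftArray w q b (i - p) c.rev + w * shiftArray w q b (i - p) (c.rev + 1) :=
  vecMul_valueMat_rev w (shiftArray w q b (i - p)) (shiftArray_of_lt _ _ _ (by omega)) c

lemma sum_vecMul_shiftMatrix {N p : ℕ} {w : ℝ} {q b : ℕ → ℝ} (hw : w ≠ 0)
    (hq₀ : q 0 = p + 1) (hq : ∀ j, q (j + 1) = 1) (i c : Fin N) :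
    (∑ j ∈ Finset.Iic i, Matrix.vecMul (shiftMatrix N p w q b j) (valueMat N w)) c =
      (if (i : ℕ) ≤ p then (i : ℝ) + 1 else 1) * shiftMatrix N p w q b i c := by
  obtain ⟨n, hn⟩ := i
  induction n with
  | zero =>
    have : Finset.Iic (⟨0, hn⟩ : Fin N) = {⟨0, hn⟩} := by
      ext j; simp [Fin.le_def, Fin.ext_iff]
    rw [this, Finset.sum_singleton, vecMul_shiftMatrix]
    simp [shiftMatrix, shiftArray]
  | succ n ih =>
    have : Finset.Iic (⟨n + 1, hn⟩ : Fin N) =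
        insert ⟨n + 1, hn⟩ (Finset.Iic ⟨n, by omega⟩) := by
      ext j
      simp only [Finset.mem_Iic, Finset.mem_insert, Fin.le_def, Fin.ext_iff]
      omega
    rw [this, Finset.sum_insert (by simp [Fin.le_def]), Pi.add_apply, ih, vecMul_shiftMatrix]
    simp only [shiftMatrix, Matrix.of_apply]
    rcases lt_trichotomy n p with h | rfl | h
    · rw [if_pos h.le, if_pos (by omega), Nat.sub_eq_zero_of_le h.le,
        Nat.sub_eq_zero_of_le (by omega : n + 1 ≤ p)]
      simp only [shiftArray]
      push_cast
      ring
    · rw [if_pos le_rfl, if_neg (by omega), Nat.sub_self, Nat.add_sub_cancel_left]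
      simp only [shiftArray, hq₀]
      field_simp
      ring
    · obtain ⟨j, rfl⟩ := Nat.exists_eq_add_of_lt h
      rw [if_neg (by omega), if_neg (by omega), show p + j + 1 - p = j + 1 by omega,
        show p + j + 1 + 1 - p = j + 1 + 1 by omega, shiftArray, hq]
      field_simp
      ring

lemma rank_shiftMatrix {N k : ℕ} {w : ℝ} {q b : ℕ → ℝ} (hw : w ≠ 0) (hq : ∀ j, q j ≠ 0)
    (hb : b 0 ≠ 0) (hk : 1 ≤ k) (hkN : k ≤ N) :
    (shiftMatrix N (N - k) w q b).rank = k := by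
  set f : Fin k → Fin N → ℝ := fun t c => shiftArray w q b t c.rev with hf
  have range_eq : Set.range (shiftMatrix N (N - k) w q b).row = Set.range f := by
    ext v
    constructor
    · rintro ⟨i, rfl⟩
      exact ⟨⟨i - (N - k), by omega⟩, rfl⟩
    · rintro ⟨t, rfl⟩
      refine ⟨⟨t + (N - k), by omega⟩, ?_⟩
      ext c
      simp [shiftMatrix, Matrix.row, hf]
  have indep : LinearIndependent ℝ f := by
    refine LinearIndependent.of_comp
      (LinearMap.funLeft ℝ ℝ fun l : Fin k => (Fin.castLE hkN l).rev) ?_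
    set A : Matrix (Fin k) (Fin k) ℝ := Matrix.of fun t l => shiftArray w q b t l with hA
    have comp_eq : (LinearMap.funLeft ℝ ℝ fun l : Fin k => (Fin.castLE hkN l).rev) ∘ f =
        A.row := by
      ext t l
      simp only [hf, hA, Function.comp_apply, LinearMap.funLeft_apply, Fin.rev_rev,
        Matrix.row, Matrix.of_apply, Fin.val_castLE]
    rw [comp_eq]
    refine Matrix.linearIndependent_rows_of_det_ne_zero (A := A) ?_
    rw [Matrix.det_of_isLowerTriangular A fun t l h => shiftArray_of_lt _ _ _ h]
    exact Finset.prod_ne_zero_iff.2 fun t _ => shiftArray_diag_ne_zero hw hq hb t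
  rw [Matrix.rank_eq_finrank_span_row, range_eq, finrank_span_eq_card indep, Fintype.card_fin]

/-- **Theorem 3, part 1.** For `N = d`, `w ≥ N`, and every `1 ≤ k ≤ N`, the
causal LayerNorm self-attention dynamics with `W_Q = W_K = 0` and value matrix `valueMat N w`
has at least `2^k` distinct equilibria of rank `k` with unit-norm rows; in particular the
dynamics simultaneously possesses equilibria of every rank between `1` and full. -/
theorem equilibria_of_every_rank (N : ℕ) (hN : 1 ≤ N) (w : ℝ) (hw : (N : ℝ) ≤ w) :
    ∀ k : ℕ, 1 ≤ k → k ≤ N →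
      ∃ S : Finset (Matrix (Fin N) (Fin N) ℝ),
        2 ^ k ≤ S.card ∧
        ∀ X ∈ S,
          (∀ i, ∑ j, (X i j) ^ 2 = 1) ∧
          causalUpdate N w X = X ∧
          X.rank = k := by
  intro k hk hkN
  have hN' : (1 : ℝ) ≤ N := by exact_mod_cast hN
  have hw₀ : 0 < w := by linarith
  let q : ℕ → ℝ := fun j => if j = 0 then ((N - k : ℕ) : ℝ) + 1 else 1
  have hq_pos : ∀ j, 0 < q j := fun j => by
    simp only [q]; split_ifs <;> positivity
  have hq_lt : ∀ j, j + 1 < k → q j < w := fun j hj => by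
    have h₁ : ((N - k : ℕ) : ℝ) + 1 < N := by
      exact_mod_cast (by omega : N - k + 1 < N)
    have h₂ : (0 : ℝ) ≤ ((N - k : ℕ) : ℝ) := Nat.cast_nonneg _
    simp only [q]; split_ifs <;> linarith
  have hsq_pos : ∀ j, j + 1 < k → 0 < 1 - (q j / w) ^ 2 := fun j hj => by
    have h₁ : 0 < q j / w := div_pos (hq_pos j) hw₀
    have h₂ : q j / w < 1 := (div_lt_one hw₀).2 (hq_lt j hj)
    nlinarith
  let a : ℕ → ℝ := fun j => j.casesOn 1 fun j => √(1 - (q j / w) ^ 2)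
  have ha : ∀ j, j < k → 0 < a j := fun j hj => by
    cases j with
    | zero => exact one_pos
    | succ j => exact Real.sqrt_pos.2 (hsq_pos j hj)
  let b : (Fin k → Bool) → ℕ → ℝ := fun σ j =>
    if h : j < k then (if σ ⟨j, h⟩ then a j else -a j) else 0
  have hb_sq : ∀ σ j, j < k → b σ j ^ 2 = a j ^ 2 := fun σ j hj => by
    simp only [b, dif_pos hj]; split_ifs <;> ring
  have hb₀ : ∀ σ, b σ 0 ^ 2 = 1 := fun σ => by
    rw [hb_sq σ 0 hk]; exact one_pow 2
  have inj : Function.Injective fun σ => shiftMatrix N (N - k) w q (b σ) := by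
    intro σ τ h
    ext ⟨t, ht⟩
    have h_entry := congrFun (congrFun h ⟨t + (N - k), by omega⟩) (⟨0, hN⟩ : Fin N).rev
    simp only [shiftMatrix, Matrix.of_apply, Fin.rev_rev, Nat.add_sub_cancel,
      shiftArray_zero_right, b, dif_pos ht] at h_entry
    have := ha t ht
    cases hσ : σ ⟨t, ht⟩ <;> cases hτ : τ ⟨t, ht⟩ <;> simp [hσ, hτ] at h_entry ⊢ <;> linarith
  refine ⟨Finset.univ.map ⟨_, inj⟩, by simp, ?_⟩
  intro X hX
  obtain ⟨σ, -, rfl⟩ := Finset.mem_map.1 hX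
  have unit : ∀ i, ∑ c, shiftMatrix N (N - k) w q (b σ) i c ^ 2 = 1 := fun i => by
    simp only [shiftMatrix, Matrix.of_apply]
    refine (Equiv.sum_comp Fin.revPerm
      (fun l : Fin N => shiftArray w q (b σ) (i - (N - k)) l ^ 2)).trans ?_
    rw [Fin.sum_univ_eq_sum_range (fun l => shiftArray w q (b σ) (i - (N - k)) l ^ 2)]
    refine sum_sq_shiftArray (k := k) (hb₀ σ) (fun j hj => ?_) (by omega) (by omega)
    rw [hb_sq σ _ hj]
    exact Real.sq_sqrt (hsq_pos j hj).le
  refine ⟨unit, ?_, ?_⟩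
  · exact causalUpdate_eq_self unit _ (fun i => by split_ifs <;> positivity)
      (sum_vecMul_shiftMatrix hw₀.ne' (if_pos rfl) fun j => if_neg j.succ_ne_zero)
  · refine rank_shiftMatrix hw₀.ne' (fun j => (hq_pos j).ne') (fun h => ?_) hk hkN
    simpa [h] using hb₀ σ
end

section
/- Let w > 1 and let X ∈ ℝ^{N×d} have all rows of unit Euclidean norm, with X_{1,d}² = 1 and X_{i,d}² ≥ 1 − 1/w² for all i ∈ {2,…,N}. Then ‖X‖_F² = N, ‖X‖₂² ≥ 1 + (N−1)(1 − 1/w²), and therefore the stable rank satisfies 1 ≤ ‖X‖_F² / ‖X‖₂² ≤ N / (N − (N−1)/w²). Consequently, for any δ > 0, if w ≥ √(1/δ + 1), then the stable rank of X is at most 1 + δ; in particular the full-rank equilibria of the causal LayerNorm self-attention dynamics are anisotropic, lying in a narrow region of the sphere. -/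
theorem sum_sq_col_le_specNorm_sq {n m : ℕ} (M : Matrix (Fin n) (Fin m) ℝ) (j : Fin m) :
    ∑ i, (M i j) ^ 2 ≤ specNorm M ^ 2 := by
  have h := (LinearMap.toContinuousLinearMap (Matrix.toEuclideanLin M)).le_opNorm
    (EuclideanSpace.single j (1 : ℝ))
  rw [PiLp.norm_single, norm_one, mul_one] at h
  have h2 := pow_le_pow_left₀ (norm_nonneg _) h 2
  rw [EuclideanSpace.norm_sq_eq] at h2
  simpa [specNorm, Matrix.toLpLin_apply] using h2

theorem specNorm_sq_le_sum_sq {n m : ℕ} (M : Matrix (Fin n) (Fin m) ℝ) :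
    specNorm M ^ 2 ≤ ∑ i, ∑ k, (M i k) ^ 2 := by
  have hF : 0 ≤ ∑ i, ∑ k, (M i k) ^ 2 := by positivity
  have h : specNorm M ≤ √(∑ i, ∑ k, (M i k) ^ 2) := by
    refine ContinuousLinearMap.opNorm_le_bound _ (Real.sqrt_nonneg _) fun v ↦ ?_
    rw [← sq_le_sq₀ (norm_nonneg _) (by positivity), mul_pow, Real.sq_sqrt hF,
      EuclideanSpace.norm_sq_eq, EuclideanSpace.norm_sq_eq, Finset.sum_mul]
    refine Finset.sum_le_sum fun i _ ↦ ?_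
    simpa [Matrix.toLpLin_apply, Matrix.mulVec, dotProduct] using
      Finset.sum_mul_sq_le_sq_mul_sq Finset.univ (M i) v
  calc specNorm M ^ 2 ≤ √(∑ i, ∑ k, (M i k) ^ 2) ^ 2 := pow_le_pow_left₀ (norm_nonneg _) h 2
    _ = _ := Real.sq_sqrt hF

/-- If `X ∈ ℝ^{N×d}` has unit-norm rows, its first row has `X_{1,d}² = 1`,
and every other row satisfies `X_{i,d}² ≥ 1 - 1/w²` (`w > 1`), then `‖X‖_F² = N`,
`‖X‖₂² ≥ 1 + (N-1)(1 - 1/w²)`, and the stable rank satisfies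
`1 ≤ ‖X‖_F²/‖X‖₂² ≤ N/(N - (N-1)/w²)`; consequently, for any `δ > 0`, if
`w ≥ √(1/δ + 1)` then the stable rank is at most `1 + δ`. -/
theorem anisotropy_stable_rank
    (N d : ℕ) (hN : 0 < N) (hd : 0 < d) (w : ℝ) (hw : 1 < w)
    (X : Matrix (Fin N) (Fin d) ℝ)
    (hunit : ∀ i, ∑ k, (X i k) ^ 2 = 1)
    (hfirst : (X ⟨0, hN⟩ ⟨d - 1, Nat.sub_lt hd one_pos⟩) ^ 2 = 1)
    (hrest : ∀ i : Fin N, i ≠ ⟨0, hN⟩ →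
      1 - 1 / w ^ 2 ≤ (X i ⟨d - 1, Nat.sub_lt hd one_pos⟩) ^ 2) :
    (∑ i, ∑ k, (X i k) ^ 2) = (N : ℝ) ∧
    1 + ((N : ℝ) - 1) * (1 - 1 / w ^ 2) ≤ specNorm X ^ 2 ∧
    1 ≤ (∑ i, ∑ k, (X i k) ^ 2) / specNorm X ^ 2 ∧
    (∑ i, ∑ k, (X i k) ^ 2) / specNorm X ^ 2 ≤
      (N : ℝ) / ((N : ℝ) - ((N : ℝ) - 1) / w ^ 2) ∧
    ∀ δ : ℝ, 0 < δ → Real.sqrt (1 / δ + 1) ≤ w →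
      (∑ i, ∑ k, (X i k) ^ 2) / specNorm X ^ 2 ≤ 1 + δ := by
  have hw2 : 1 < w ^ 2 := by nlinarith
  have hN1 : (1 : ℝ) ≤ N := by exact_mod_cast hN
  have hF : ∑ i, ∑ k, (X i k) ^ 2 = (N : ℝ) := by simp [hunit]
  have hcol : 1 + ((N : ℝ) - 1) * (1 - 1 / w ^ 2) ≤ specNorm X ^ 2 := by
    refine le_trans ?_ (sum_sq_col_le_specNorm_sq X ⟨d - 1, Nat.sub_lt hd one_pos⟩)
    rw [← Finset.add_sum_erase _ _ (Finset.mem_univ (⟨0, hN⟩ : Fin N)), hfirst]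
    gcongr
    have h := Finset.card_nsmul_le_sum (Finset.univ.erase (⟨0, hN⟩ : Fin N))
      (fun i ↦ (X i ⟨d - 1, Nat.sub_lt hd one_pos⟩) ^ 2) (1 - 1 / w ^ 2)
      fun i hi ↦ hrest i (Finset.ne_of_mem_erase hi)
    rwa [Finset.card_erase_of_mem (Finset.mem_univ _), Finset.card_univ, Fintype.card_fin,
      nsmul_eq_mul, Nat.cast_sub hN, Nat.cast_one] at h
  have hinv : 1 / w ^ 2 < 1 := (div_lt_one (by positivity)).2 hw2
  have hden : (N : ℝ) - ((N : ℝ) - 1) / w ^ 2 = 1 + ((N : ℝ) - 1) * (1 - 1 / w ^ 2) := by ring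
  have hpos : 0 < 1 + ((N : ℝ) - 1) * (1 - 1 / w ^ 2) := by
    have := mul_nonneg (sub_nonneg.2 hN1) (sub_nonneg.2 hinv.le)
    linarith
  have hub : (N : ℝ) / specNorm X ^ 2 ≤ N / (N - (N - 1) / w ^ 2) := by
    rw [hden]
    gcongr
  have hle := specNorm_sq_le_sum_sq X
  rw [hF] at hle ⊢
  refine ⟨rfl, hcol, (one_le_div (hpos.trans_le hcol)).2 hle, hub, fun δ hδ hwδ ↦
    hub.trans ?_⟩
  have hδw : 1 / δ + 1 ≤ w ^ 2 := (Real.sqrt_le_iff.1 hwδ).2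
  have hinvδ : (1 + δ) * (1 / w ^ 2) ≤ δ := by
    rw [mul_one_div, div_le_iff₀ (by positivity)]
    calc 1 + δ = δ * (1 / δ + 1) := by field_simp
      _ ≤ δ * w ^ 2 := by gcongr
  rw [hden, div_le_iff₀ hpos]
  have hδN := mul_le_mul_of_nonneg_left hinvδ (sub_nonneg.2 hN1)
  linarith
end
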